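/- Let G be one of the following coloured graphs: the empty graph, a b-path, a br-path, a brb-path, a brr-path, or a brrb-path. Then for every n ≥ 8, Builder has a winning strategy in the game RR(C4, Pn, G). -/

import Mathlib

/-!
The game `RR(C₄, Pₙ, H)`: the board is `K_ℕ` on which a coloured graph `H`
(with red edge set `R₀` and blue edge set `B₀`) is initially placed.  In each
round Builder selects a previously uncoloured edge and Painter colours it red
(`true`) or blue (`false`), except that Painter may never colour an edge red
if the red edges would then contain a `C₄`.  Builder wins if `e(H) ≤ 2n - 2`
and after at most `2n - 2 - e(H)` rounds the blue edges number exactly `n - 1`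
and contain a path on `n` vertices.
-/

namespace OnlineRamsey

abbrev Edge := Sym2 ℕ
abbrev History := List (Edge × Bool)   -- `true` = red, `false` = blue
abbrev BuilderStrat := History → Edge
abbrev PainterStrat := History → Edge → Bool

/-- The history of coloured edges after `t` rounds (not counting the initial
coloured graph), when Builder follows `B` and Painter follows `P`. -/
def gamePlay (B : BuilderStrat) (P : PainterStrat) : ℕ → History
  | 0 => []
  | t + 1 =>
      let h := gamePlay B P t
      h ++ [(B h, P h (B h))]

/-- All red edges: the initially placed ones together with those coloured red. -/
def redSet (R₀ : Set Edge) (h : History) : Set Edge := R₀ ∪ {e | (e, true) ∈ h}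

/-- All blue edges: the initially placed ones together with those coloured blue. -/
def blueSet (B₀ : Set Edge) (h : History) : Set Edge := B₀ ∪ {e | (e, false) ∈ h}

/-- `H` contains a copy of `G`. -/
def HasCopy {α β : Type} (G : SimpleGraph α) (H : SimpleGraph β) : Prop :=
  ∃ f : G →g H, Function.Injective f

/-- Painter never colours an edge red if the red edges would then contain a `C₄`. -/
def PainterLegal (R₀ : Set Edge) (P : PainterStrat) : Prop :=
  ∀ (h : History) (e : Edge), P h e = true →
    ¬ HasCopy (SimpleGraph.cycleGraph 4)
        (SimpleGraph.fromEdgeSet (insert e (redSet R₀ h)))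

/-- During the first `m` rounds Builder always selects a previously uncoloured
(non-loop) edge. -/
def BuilderLegal (R₀ B₀ : Set Edge) (B : BuilderStrat) (m : ℕ) : Prop :=
  ∀ P : PainterStrat, ∀ t < m,
    ¬ (B (gamePlay B P t)).IsDiag ∧
      B (gamePlay B P t) ∉ redSet R₀ (gamePlay B P t) ∪ blueSet B₀ (gamePlay B P t)

/-- Builder has a winning strategy in the game `RR(C₄, Pₙ, H)`, where the initial
coloured graph `H` has red edge set `R₀` and blue edge set `B₀`. -/
def RRWin (n : ℕ) (R₀ B₀ : Set Edge) : Prop :=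
  (R₀ ∪ B₀).ncard ≤ 2 * n - 2 ∧
  ∃ B : BuilderStrat, BuilderLegal R₀ B₀ B (2 * n - 2 - (R₀ ∪ B₀).ncard) ∧
    ∀ P : PainterStrat, PainterLegal R₀ P →
      ∃ t ≤ 2 * n - 2 - (R₀ ∪ B₀).ncard,
        (blueSet B₀ (gamePlay B P t)).ncard = n - 1 ∧
        HasCopy (SimpleGraph.pathGraph n)
          (SimpleGraph.fromEdgeSet (blueSet B₀ (gamePlay B P t)))


/-! ### Recursive form of the game -/

/-- The red edges contain a four-cycle. -/
def C4 (R : Set Edge) : Prop :=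
  HasCopy (SimpleGraph.cycleGraph 4) (SimpleGraph.fromEdgeSet R)

/-- Builder has already won. -/
def Done (n : ℕ) (B : Set Edge) : Prop :=
  B.ncard = n - 1 ∧ HasCopy (SimpleGraph.pathGraph n) (SimpleGraph.fromEdgeSet B)

/-- Builder can choose `e` and win within `m` further rounds, whatever the colour of `e`,
where `W` is the winning predicate with `m` rounds. -/
def GoodMove (W : Set Edge → Set Edge → Prop) (R B : Set Edge) (e : Edge) : Prop :=
  ¬ e.IsDiag ∧ e ∉ R ∪ B ∧ W R (insert e B) ∧ (C4 (insert e R) ∨ W (insert e R) B)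

/-- Builder wins from the position `(R, B)` within `m` rounds. -/
def WinIn (n : ℕ) : ℕ → Set Edge → Set Edge → Prop
  | 0 => fun _ B => Done n B
  | m + 1 => fun R B => Done n B ∨ ∃ e, GoodMove (WinIn n m) R B e

lemma WinIn.succ {n : ℕ} : ∀ {m : ℕ} {R B : Set Edge}, WinIn n m R B → WinIn n (m + 1) R B
  | 0, _, _, h => Or.inl h
  | m + 1, R, B, h => by
    rcases h with h | ⟨e, h1, h2, h3, h4⟩
    · exact Or.inl h
    · exact Or.inr ⟨e, h1, h2, h3.succ, h4.imp id fun h => h.succ⟩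

lemma WinIn.mono {n m m' : ℕ} {R B : Set Edge} (h : WinIn n m R B) (hm : m ≤ m') :
    WinIn n m' R B := by
  induction m', hm using Nat.le_induction with
  | base => exact h
  | succ k _ ih => exact ih.succ

lemma exists_fresh (X : Set Edge) (hX : X.Finite) : ∃ e : Edge, ¬ e.IsDiag ∧ e ∉ X := by
  have hinf : (Set.range fun i : ℕ => (s(0, i + 1) : Edge)).Infinite := by
    apply Set.infinite_range_of_injective
    intro i j h
    have := Sym2.congr_right.1 h
    omega
  obtain ⟨e, ⟨i, rfl⟩, he⟩ := hinf.exists_notMem_finite hX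
  exact ⟨_, by simp, he⟩

lemma redSet_append (R₀ : Set Edge) (h : History) (e : Edge) (c : Bool) :
    redSet R₀ (h ++ [(e, c)]) = if c = true then insert e (redSet R₀ h) else redSet R₀ h := by
  ext x
  cases c <;> simp [redSet] <;> tauto

lemma blueSet_append (R₀ : Set Edge) (h : History) (e : Edge) (c : Bool) :
    blueSet R₀ (h ++ [(e, c)]) = if c = true then blueSet R₀ h else insert e (blueSet R₀ h) := by
  ext x
  cases c <;> simp [blueSet] <;> tauto

lemma hist_finite (h : History) (c : Bool) : {e | (e, c) ∈ h}.Finite := by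
  have : (Set.image Prod.fst {x | x ∈ h}).Finite := (List.finite_toSet h).image _
  exact this.subset fun e he => ⟨(e, c), he, rfl⟩

lemma gamePlay_length (S : BuilderStrat) (P : PainterStrat) (t : ℕ) :
    (gamePlay S P t).length = t := by
  induction t with
  | zero => rfl
  | succ t ih => simp [gamePlay, ih]

open Classical in
/-- The strategy that follows winning moves. -/
noncomputable def strat (n M : ℕ) (R₀ B₀ : Set Edge) : BuilderStrat := fun h =>
  if h1 : ∃ e, GoodMove (WinIn n (M - h.length - 1)) (redSet R₀ h) (blueSet B₀ h) e then h1.choose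
  else if h2 : ∃ e : Edge, ¬ e.IsDiag ∧ e ∉ redSet R₀ h ∪ blueSet B₀ h then h2.choose
  else s(0, 1)

lemma strat_spec {n M : ℕ} {R₀ B₀ : Set Edge} {h : History}
    (h1 : ∃ e, GoodMove (WinIn n (M - h.length - 1)) (redSet R₀ h) (blueSet B₀ h) e) :
    GoodMove (WinIn n (M - h.length - 1)) (redSet R₀ h) (blueSet B₀ h) (strat n M R₀ B₀ h) := by
  unfold strat
  rw [dif_pos h1]
  exact h1.choose_spec

lemma strat_legal {n M : ℕ} {R₀ B₀ : Set Edge} (hR : R₀.Finite) (hB : B₀.Finite) (h : History) :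
    ¬ (strat n M R₀ B₀ h).IsDiag ∧
      strat n M R₀ B₀ h ∉ redSet R₀ h ∪ blueSet B₀ h := by
  by_cases h1 : ∃ e, GoodMove (WinIn n (M - h.length - 1)) (redSet R₀ h) (blueSet B₀ h) e
  · have := strat_spec h1
    exact ⟨this.1, this.2.1⟩
  · have h2 := exists_fresh (redSet R₀ h ∪ blueSet B₀ h)
      ((hR.union (hist_finite h true)).union (hB.union (hist_finite h false)))
    unfold strat
    rw [dif_neg h1, dif_pos h2]
    exact h2.choose_spec

theorem RRWin_of_WinIn {n : ℕ} {R₀ B₀ : Set Edge} (hR : R₀.Finite) (hB : B₀.Finite)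
    (hc : (R₀ ∪ B₀).ncard ≤ 2 * n - 2)
    (h : WinIn n (2 * n - 2 - (R₀ ∪ B₀).ncard) R₀ B₀) : RRWin n R₀ B₀ := by
  refine ⟨hc, strat n (2 * n - 2 - (R₀ ∪ B₀).ncard) R₀ B₀,
    fun P t _ => strat_legal hR hB _, fun P hP => ?_⟩
  generalize hM : 2 * n - 2 - (R₀ ∪ B₀).ncard = M at h ⊢
  set S := strat n M R₀ B₀ with hS
  have key : ∀ m t, t + m = M → WinIn n m (redSet R₀ (gamePlay S P t))
      (blueSet B₀ (gamePlay S P t)) → ∃ t ≤ M, Done n (blueSet B₀ (gamePlay S P t)) := by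
    intro m
    induction m with
    | zero => intro t ht hw; exact ⟨t, by omega, hw⟩
    | succ m ih =>
      intro t ht hw
      rcases hw with hw | hw
      · exact ⟨t, by omega, hw⟩
      have hlen : M - (gamePlay S P t).length - 1 = m := by
        rw [gamePlay_length]; omega
      have hsp : GoodMove (WinIn n m) (redSet R₀ (gamePlay S P t))
          (blueSet B₀ (gamePlay S P t)) (S (gamePlay S P t)) := by
        have := strat_spec (n := n) (M := M) (R₀ := R₀) (B₀ := B₀) (h := gamePlay S P t)
          (by rw [hlen]; exact hw)
        rwa [hlen] at this
      obtain ⟨_, _, hb, hr⟩ := hsp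
      apply ih (t + 1) (by omega)
      change WinIn n m (redSet R₀ (gamePlay S P t ++ [_])) (blueSet B₀ (gamePlay S P t ++ [_]))
      rw [redSet_append, blueSet_append]
      cases hcol : P (gamePlay S P t) (S (gamePlay S P t)) with
      | false => simpa using hb
      | true =>
        simp only [if_true]
        exact hr.resolve_left (hP _ _ hcol)
  exact key M 0 (by omega) (by simpa [gamePlay, redSet, blueSet] using h)

/-! ### Linear forests -/

/-- The list of edges of a path given by its list of vertices. -/
def pe : List ℕ → List Edge
  | a :: b :: l => s(a, b) :: pe (b :: l)
  | _ => []

lemma pe_length : ∀ l : List ℕ, (pe l).length = l.length - 1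
  | [] => rfl
  | [_] => rfl
  | a :: b :: l => by simp [pe, pe_length (b :: l)]

lemma mem_of_pe {a b : ℕ} : ∀ {l : List ℕ}, s(a, b) ∈ pe l → a ∈ l ∧ b ∈ l
  | [], h => by simp [pe] at h
  | [_], h => by simp [pe] at h
  | c :: d :: l, h => by
    simp only [pe, List.mem_cons] at h
    rcases h with h | h
    · rw [Sym2.eq_iff] at h
      rcases h with ⟨rfl, rfl⟩ | ⟨rfl, rfl⟩ <;> simp
    · have := mem_of_pe h
      exact ⟨List.mem_cons_of_mem _ this.1, List.mem_cons_of_mem _ this.2⟩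

lemma mem_pe_append {x y : ℕ} {e : Edge} {m : List ℕ} (hm : m.head? = some y) :
    ∀ {l : List ℕ}, l.getLast? = some x →
      (e ∈ pe (l ++ m) ↔ e ∈ pe l ∨ e = s(x, y) ∨ e ∈ pe m)
  | [], h => by simp at h
  | [a], h => by
    cases m with
    | nil => simp at hm
    | cons c m =>
      simp at h hm
      subst h hm
      simp [pe]
  | a :: b :: l, h => by
    have ih := mem_pe_append (e := e) hm (l := b :: l) (by simpa using h)
    simp only [List.cons_append, pe, List.mem_cons] at ih ⊢
    rw [ih]; tauto

lemma mem_pe_reverse {e : Edge} : ∀ {l : List ℕ}, e ∈ pe l.reverse ↔ e ∈ pe l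
  | [] => by simp
  | [a] => by simp
  | a :: b :: l => by
    have ih := mem_pe_reverse (e := e) (l := b :: l)
    rw [List.reverse_cons, mem_pe_append (y := a) (x := b) (by simp) (by simp), ih]
    simp only [pe, List.mem_cons, List.not_mem_nil, or_false]
    rw [Sym2.eq_swap]; tauto

lemma getElem_pe : ∀ {l : List ℕ} {i : ℕ} (h : i + 1 < l.length), s(l[i], l[i + 1]) ∈ pe l
  | [], i, h => by simp at h
  | [_], i, h => by simp at h
  | a :: b :: l, 0, h => by simp [pe]
  | a :: b :: l, i + 1, h => by
    have := getElem_pe (l := b :: l) (i := i) (by simpa using h)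
    simp only [pe, List.mem_cons]
    exact Or.inr (by simpa using this)

lemma hasCopy_path {n : ℕ} {B : Set Edge} {l : List ℕ} (hl : n ≤ l.length) (hn : l.Nodup)
    (hB : ∀ e ∈ pe l, e ∈ B) : HasCopy (SimpleGraph.pathGraph n) (SimpleGraph.fromEdgeSet B) := by
  have hinj : Function.Injective (fun i : Fin n => l[i.1]'(i.2.trans_le hl)) := by
    intro i j hij
    exact Fin.ext ((List.Nodup.getElem_inj_iff hn).1 hij)
  refine ⟨⟨fun i => l[i.1]'(i.2.trans_le hl), ?_⟩, hinj⟩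
  intro i j hij
  rw [SimpleGraph.fromEdgeSet_adj]
  refine ⟨?_, fun h => hij.ne (hinj h)⟩
  rw [SimpleGraph.pathGraph_adj] at hij
  apply hB
  rcases hij with h | h
  · have := getElem_pe (l := l) (i := i.1) (by omega)
    simpa only [h] using this
  · have := getElem_pe (l := l) (i := j.1) (by omega)
    rw [Sym2.eq_swap]
    simpa only [h] using this

/-- `B` is a linear forest; for each vertex `v` outside the set `D` of inner vertices `q v` is the
path starting at `v`, which ends at `p v`. -/
structure Good (p : ℕ → ℕ) (q : ℕ → List ℕ) (D : Set ℕ) (B : Set Edge) : Prop where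
  pD : ∀ v, v ∉ D → p v ∉ D
  pp : ∀ v, v ∉ D → p (p v) = v
  hd : ∀ v, v ∉ D → (q v).head? = some v
  rv : ∀ v, v ∉ D → q (p v) = (q v).reverse
  nd : ∀ v, v ∉ D → (q v).Nodup
  dj : ∀ u v w, u ∉ D → v ∉ D → w ∈ q u → w ∈ q v → u = v ∨ u = p v
  ed : ∀ e, e ∈ B ↔ ∃ v, v ∉ D ∧ e ∈ pe (q v)

lemma good_empty : Good id (fun v => [v]) ∅ ∅ := by
  constructor <;> simp [pe]

/-- New end function after joining `x` and `y`. -/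
def jp (p : ℕ → ℕ) (x y : ℕ) : ℕ → ℕ := fun v =>
  if v = p x then p y else if v = p y then p x else p v

/-- New paths after joining `x` and `y`. -/
def jq (p : ℕ → ℕ) (q : ℕ → List ℕ) (x y : ℕ) : ℕ → List ℕ := fun v =>
  if v = p x then q (p x) ++ q y else if v = p y then (q (p x) ++ q y).reverse else q v

/-- New inner vertices after joining `x` and `y`. -/
def jD (p : ℕ → ℕ) (D : Set ℕ) (x y : ℕ) : Set ℕ :=
  {v | v ∈ D ∨ (v = x ∧ p x ≠ x) ∨ (v = y ∧ p y ≠ y)}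

section
variable {p : ℕ → ℕ} {q : ℕ → List ℕ} {D : Set ℕ} {B : Set Edge} {x y : ℕ}

lemma Good.self_mem (g : Good p q D B) {v : ℕ} (hv : v ∉ D) : v ∈ q v :=
  List.mem_of_mem_head? (g.hd v hv)

lemma Good.mem_p (g : Good p q D B) {v w : ℕ} (hv : v ∉ D) : w ∈ q (p v) ↔ w ∈ q v := by
  rw [g.rv v hv, List.mem_reverse]

lemma Good.last (g : Good p q D B) {v : ℕ} (hv : v ∉ D) : (q (p v)).getLast? = some v := by
  rw [g.rv v hv, List.getLast?_reverse, g.hd v hv]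

lemma Good.notMem (g : Good p q D B) (hx : x ∉ D) (hy : y ∉ D) (hxy : x ≠ y) (hp : p x ≠ y) :
    s(x, y) ∉ B := by
  intro h
  obtain ⟨v, hv, h⟩ := (g.ed _).1 h
  obtain ⟨h1, h2⟩ := mem_of_pe h
  have a1 := g.dj x v x hx hv (g.self_mem hx) h1
  have a2 := g.dj y v y hy hv (g.self_mem hy) h2
  have a3 := g.pp v hv
  grind

lemma Good.join (g : Good p q D B) (hx : x ∉ D) (hy : y ∉ D) (hxy : x ≠ y) (hp : p x ≠ y) :
    Good (jp p x y) (jq p q x y) (jD p D x y) (insert s(x, y) B) := by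
  have ppx := g.pp x hx
  have ppy := g.pp y hy
  have pxD := g.pD x hx
  have pyD := g.pD y hy
  have hpp : p x ≠ p y := by grind
  have hpy : p y ≠ x := by grind
  have hL : ∀ w, w ∈ q (p x) ++ q y ↔ w ∈ q x ∨ w ∈ q y := by
    intro w; rw [List.mem_append, g.mem_p hx]
  have hdl : ∀ w, w ∈ q x → w ∉ q y := by
    intro w h1 h2
    have := g.dj x y w hx hy h1 h2
    grind
  have hlive : ∀ v, v ∉ jD p D x y → v ≠ p x → v ≠ p y → v ∉ D ∧ v ≠ x ∧ v ≠ y := by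
    intro v h h1 h2
    simp only [jD, Set.mem_ofPred_eq] at h
    grind
  have hliveD : ∀ v, v ∉ jD p D x y → v ∉ D := by
    intro v h; simp only [jD, Set.mem_ofPred_eq] at h; tauto
  have hpx' : p x ∉ jD p D x y := by simp only [jD, Set.mem_ofPred_eq]; grind
  have hpy' : p y ∉ jD p D x y := by simp only [jD, Set.mem_ofPred_eq]; grind
  have hLe : ∀ e, e ∈ pe (q (p x) ++ q y) ↔ e ∈ pe (q x) ∨ e = s(x, y) ∨ e ∈ pe (q y) := by
    intro e
    rw [mem_pe_append (g.hd y hy) (g.last hx), g.rv x hx, mem_pe_reverse]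
  have qpx : jq p q x y (p x) = q (p x) ++ q y := by simp [jq]
  have qpy : jq p q x y (p y) = (q (p x) ++ q y).reverse := by
    simp [jq, hpp.symm]
  have qo : ∀ v, v ≠ p x → v ≠ p y → jq p q x y v = q v := by
    intro v h1 h2; simp [jq, h1, h2]
  have ppx' : jp p x y (p x) = p y := by simp [jp]
  have ppy' : jp p x y (p y) = p x := by simp [jp, hpp.symm]
  have po : ∀ v, v ≠ p x → v ≠ p y → jp p x y v = p v := by
    intro v h1 h2; simp [jp, h1, h2]
  have hmem : ∀ v w, v ∉ jD p D x y → w ∈ jq p q x y v →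
      ((v = p x ∨ v = p y) ∧ (w ∈ q x ∨ w ∈ q y)) ∨ (v ≠ p x ∧ v ≠ p y ∧ w ∈ q v) := by
    intro v w hv hw
    by_cases h1 : v = p x
    · subst h1; rw [qpx, hL] at hw; tauto
    by_cases h2 : v = p y
    · subst h2; rw [qpy, List.mem_reverse, hL] at hw; tauto
    rw [qo v h1 h2] at hw; tauto
  have hother : ∀ v, v ∉ jD p D x y → v ≠ p x → v ≠ p y →
      p v ≠ p x ∧ p v ≠ p y ∧ p v ≠ x ∧ p v ≠ y := by
    intro v hv h1 h2
    have := hlive v hv h1 h2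
    have := g.pp v this.1
    grind
  refine ⟨?_, ?_, ?_, ?_, ?_, ?_, ?_⟩
  · intro v hv
    by_cases h1 : v = p x
    · rw [h1, ppx']; exact hpy'
    by_cases h2 : v = p y
    · rw [h2, ppy']; exact hpx'
    rw [po v h1 h2]
    have a := hlive v hv h1 h2
    have b := hother v hv h1 h2
    have c := g.pD v a.1
    simp only [jD, Set.mem_ofPred_eq]; tauto
  · intro v hv
    by_cases h1 : v = p x
    · rw [h1, ppx', ppy']
    by_cases h2 : v = p y
    · rw [h2, ppy', ppx']
    have b := hother v hv h1 h2
    rw [po v h1 h2, po _ b.1 b.2.1, g.pp v (hliveD v hv)]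
  · intro v hv
    by_cases h1 : v = p x
    · rw [h1, qpx, List.head?_append, g.hd _ pxD]; rfl
    by_cases h2 : v = p y
    · rw [h2, qpy, List.head?_reverse, List.getLast?_append]
      have := g.last pyD
      rw [ppy] at this
      rw [this]; rfl
    rw [qo v h1 h2, g.hd v (hliveD v hv)]
  · intro v hv
    by_cases h1 : v = p x
    · rw [h1, ppx', qpx, qpy]
    by_cases h2 : v = p y
    · rw [h2, ppy', qpx, qpy, List.reverse_reverse]
    have b := hother v hv h1 h2
    rw [po v h1 h2, qo v h1 h2, qo _ b.1 b.2.1, g.rv v (hliveD v hv)]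
  · have hLn : (q (p x) ++ q y).Nodup := by
      rw [List.nodup_append']
      refine ⟨g.nd _ pxD, g.nd _ hy, ?_⟩
      intro w h1 h2
      rw [g.mem_p hx] at h1
      exact hdl w h1 h2
    intro v hv
    by_cases h1 : v = p x
    · rw [h1, qpx]; exact hLn
    by_cases h2 : v = p y
    · rw [h2, qpy, List.nodup_reverse]; exact hLn
    rw [qo v h1 h2]; exact g.nd v (hliveD v hv)
  · intro u v w hu hv hwu hwv
    have a1 := hmem u w hu hwu
    have a2 := hmem v w hv hwv
    have b1 := hliveD u hu
    have b2 := hliveD v hv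
    rcases a1 with ⟨a1, a1'⟩ | ⟨a1, a1', a1''⟩ <;> rcases a2 with ⟨a2, a2'⟩ | ⟨a2, a2', a2''⟩
    · rcases a1 with rfl | rfl <;> rcases a2 with rfl | rfl <;> simp [ppx', ppy']
    · exfalso
      have c := hlive v hv a2 a2'
      rcases a1' with d | d
      · have := g.dj v x w b2 hx a2'' d
        tauto
      · have := g.dj v y w b2 hy a2'' d
        tauto
    · exfalso
      have c := hlive u hu a1 a1'
      rcases a2' with d | d
      · have := g.dj u x w b1 hx a1'' d
        tauto
      · have := g.dj u y w b1 hy a1'' d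
        tauto
    · rw [po v a2 a2']
      exact g.dj u v w b1 b2 a1'' a2''
  · intro e
    rw [Set.mem_insert_iff, g.ed]
    constructor
    · rintro (rfl | ⟨v, hv, he⟩)
      · exact ⟨p x, hpx', by rw [qpx, hLe]; tauto⟩
      · by_cases h1 : v = p x
        · subst h1
          refine ⟨p x, hpx', ?_⟩
          rw [qpx, hLe]
          rw [g.rv x hx, mem_pe_reverse] at he
          tauto
        by_cases h2 : v = p y
        · subst h2
          refine ⟨p x, hpx', ?_⟩
          rw [qpx, hLe]
          rw [g.rv y hy, mem_pe_reverse] at he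
          tauto
        by_cases h3 : v = x
        · subst h3
          exact ⟨p v, hpx', by rw [qpx, hLe]; tauto⟩
        by_cases h4 : v = y
        · subst h4
          exact ⟨p x, hpx', by rw [qpx, hLe]; tauto⟩
        refine ⟨v, ?_, by rw [qo v h1 h2]; exact he⟩
        simp only [jD, Set.mem_ofPred_eq]; tauto
    · rintro ⟨v, hv, he⟩
      have hfin : e ∈ pe (q (p x) ++ q y) → e = s(x, y) ∨ ∃ v, v ∉ D ∧ e ∈ pe (q v) := by
        rw [hLe]
        rintro (h | h | h)
        · exact Or.inr ⟨x, hx, h⟩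
        · exact Or.inl h
        · exact Or.inr ⟨y, hy, h⟩
      by_cases h1 : v = p x
      · rw [h1, qpx] at he; exact hfin he
      by_cases h2 : v = p y
      · rw [h2, qpy, mem_pe_reverse] at he; exact hfin he
      rw [qo v h1 h2] at he
      exact Or.inr ⟨v, hliveD v hv, he⟩

/-- If all nontrivial paths coincide, the forest is one path. -/
lemma Good.done (g : Good p q D B) {n z : ℕ} (hB : B.ncard = n - 1) (hn : 1 ≤ n)
    (hz : z ∉ D) (h1 : ∀ v, v ∉ D → p v ≠ v → v = z ∨ v = p z) : Done n B := by
  refine ⟨hB, hasCopy_path (l := q z) ?_ (g.nd z hz) fun e he => (g.ed e).2 ⟨z, hz, he⟩⟩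
  have hsub : B ⊆ {e | e ∈ pe (q z)} := by
    intro e he
    obtain ⟨v, hv, he⟩ := (g.ed e).1 he
    by_cases hpv : p v = v
    · exfalso
      have h2 := g.rv v hv
      rw [hpv] at h2
      have h3 := g.nd v hv
      have h4 := g.hd v hv
      have h5 := g.last hv
      rw [hpv] at h5
      match hq : q v with
      | [] => rw [hq] at he; simp [pe] at he
      | [a] => rw [hq] at he; simp [pe] at he
      | a :: b :: l =>
        rw [hq] at h3 h4 h5
        simp only [List.head?_cons, Option.some.injEq] at h4
        rw [List.getLast?_cons_cons] at h5
        have := List.mem_of_mem_getLast? h5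
        rw [List.nodup_cons] at h3
        exact h3.1 (h4 ▸ this)
    · rcases h1 v hv hpv with rfl | rfl
      · exact he
      · rw [g.rv z hz, mem_pe_reverse] at he; exact he
  have hcard : B.ncard ≤ (pe (q z)).length := by
    have : {e | e ∈ pe (q z)} = ((pe (q z)).toFinset : Set Edge) := by ext; simp
    calc B.ncard ≤ ((pe (q z)).toFinset : Set Edge).ncard := by
          rw [this] at hsub
          exact Set.ncard_le_ncard hsub (Finset.finite_toSet _)
      _ = (pe (q z)).toFinset.card := Set.ncard_coe_finset _
      _ ≤ _ := List.toFinset_card_le _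
  rw [pe_length] at hcard
  have : 0 < (q z).length := List.length_pos_of_mem (g.self_mem hz)
  omega

end

/-! ### Symbolic positions and strategy trees -/

/-- A symbolic position: the list of known red edges, and for each label the other end of its blue
path (`none` for inner vertices). -/
structure Pos where
  red : List (ℕ × ℕ)
  par : List (Option ℕ)

namespace Pos

def pr (s : Pos) (i : ℕ) : Option ℕ := s.par.getD i none

/-- Add a fresh vertex. -/
def ext (s : Pos) : Pos := ⟨s.red, s.par ++ [some s.par.length]⟩

/-- Add a red edge. -/
def addr (s : Pos) (x y : ℕ) : Pos := ⟨(x, y) :: s.red, s.par⟩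

/-- Add a blue edge `xy`, where `a`, `b` are the other ends of the paths at `x`, `y`. -/
def blue (s : Pos) (x y a b : ℕ) : Pos :=
  ⟨s.red, (((s.par.set x none).set y none).set a (some b)).set b (some a)⟩

/-- The edge `xy` is known to be red. -/
def adj (s : Pos) (x y : ℕ) : Bool := s.red.any fun e => (e.1 == x && e.2 == y) || (e.1 == y && e.2 == x)

end Pos

/-- The position `(R, B)` is described by `s`. -/
structure Rep (s : Pos) (f p : ℕ → ℕ) (q : ℕ → List ℕ) (D : Set ℕ) (R B : Set Edge) : Prop where
  good : Good p q D B
  finD : D.Finite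
  finB : B.Finite
  c4 : ¬ C4 R
  inj : ∀ i j, i < s.par.length → j < s.par.length → f i = f j → i = j
  par : ∀ i j, s.pr i = some j → j < s.par.length ∧ f i ∉ D ∧ p (f i) = f j
  cov : ∀ v, v ∉ D → p v ≠ v → ∃ i j, s.pr i = some j ∧ f i = v
  red : ∀ a b, (a, b) ∈ s.red → a < s.par.length ∧ b < s.par.length ∧ s(f a, f b) ∈ R

/-- Builder wins from each position described by `s` with `k` blue edges missing and `r` red
edges allowed. -/
def Win (s : Pos) (k r : ℕ) : Prop :=
  ∀ n f p q D R B, 1 ≤ n → Rep s f p q D R B → B.ncard + k = n - 1 → WinIn n (k + r) R B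

lemma Pos.pr_lt {s : Pos} {i j : ℕ} (h : s.pr i = some j) : i < s.par.length := by
  by_contra h'
  rw [Pos.pr, List.getD_eq_default _ _ (by omega)] at h
  cases h

lemma Win.mono {s : Pos} {k r r' : ℕ} (h : Win s k r) (hr : r ≤ r') : Win s k r' :=
  fun n f p q D R B h1 h2 h3 => (h n f p q D R B h1 h2 h3).mono (by omega)

lemma Rep.adj {s : Pos} {f p q D R B} (h : Rep s f p q D R B) {x y : ℕ} (ha : s.adj x y = true) :
    s(f x, f y) ∈ R := by
  simp only [Pos.adj, List.any_eq_true, Bool.or_eq_true, Bool.and_eq_true, beq_iff_eq] at ha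
  obtain ⟨⟨a, b⟩, he, ⟨rfl, rfl⟩ | ⟨rfl, rfl⟩⟩ := ha
  · exact (h.red _ _ he).2.2
  · rw [Sym2.eq_swap]; exact (h.red _ _ he).2.2

lemma Pos.pr_ext (s : Pos) (i : ℕ) :
    s.ext.pr i = if i = s.par.length then some s.par.length else s.pr i := by
  simp only [Pos.pr, Pos.ext, List.getD_eq_getElem?_getD, List.getElem?_append]
  split_ifs with h1 h2 h2
  · omega
  · rfl
  · subst h2
    rw [Nat.sub_self]
    rfl
  · rw [List.getElem?_eq_none (by simp only [List.length_singleton]; omega),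
      List.getElem?_eq_none (by omega)]

lemma Win.of_ext {s : Pos} {k r : ℕ} (h : Win s.ext k r) : Win s k r := by
  intro n f p q D R B hn hs hc
  obtain ⟨v, hv⟩ := (hs.finD.union ((Set.finite_Iio s.par.length).image f)).exists_notMem
  have hvD : v ∉ D := fun h => hv (Or.inl h)
  have hvf : ∀ i, i < s.par.length → f i ≠ v := fun i hi h => hv (Or.inr ⟨i, hi, h⟩)
  set m := s.par.length with hm
  have hpr : ∀ i j, s.ext.pr i = some j ↔ (s.pr i = some j ∨ (i = m ∧ j = m)) := by
    intro i j
    have h0 := @Pos.pr_lt s i j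
    rw [Pos.pr_ext]
    split_ifs with h1
    · constructor
      · intro h2
        exact Or.inr ⟨h1, by simpa using h2.symm⟩
      · rintro (h2 | ⟨-, rfl⟩)
        · have := h0 h2
          omega
        · rfl
    · constructor
      · exact Or.inl
      · rintro (h2 | ⟨h2, -⟩)
        · exact h2
        · exact absurd h2 h1
  have hlen : s.ext.par.length = m + 1 := by simp [Pos.ext, hm]
  have hpv : p v = v := by
    by_contra h1
    obtain ⟨i, j, h2, h3⟩ := hs.cov v hvD h1
    exact hvf i (Pos.pr_lt h2) h3
  set g : ℕ → ℕ := Function.update f m v with hg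
  have g1 : g m = v := by simp [hg]
  have g2 : ∀ i, i < m → g i = f i := fun i hi => by
    rw [hg, Function.update_of_ne (by omega)]
  refine h n g p q D R B hn ⟨hs.good, hs.finD, hs.finB, hs.c4, ?_, ?_, ?_, ?_⟩ hc
  · intro i j hi hj hij
    rw [hlen] at hi hj
    rcases Nat.lt_succ_iff_lt_or_eq.1 hi with hi | rfl <;>
      rcases Nat.lt_succ_iff_lt_or_eq.1 hj with hj | rfl
    · rw [g2 i hi, g2 j hj] at hij
      exact hs.inj i j hi hj hij
    · rw [g2 i hi, g1] at hij
      exact absurd hij (hvf i hi)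
    · rw [g1, g2 j hj] at hij
      exact absurd hij.symm (hvf j hj)
    · rfl
  · intro i j hij
    rcases (hpr i j).1 hij with h1 | ⟨rfl, rfl⟩
    · have h2 := hs.par i j h1
      rw [hlen, g2 i (Pos.pr_lt h1), g2 j h2.1]
      exact ⟨by omega, h2.2⟩
    · rw [hlen, g1]
      exact ⟨by omega, hvD, hpv⟩
  · intro w hw hw'
    obtain ⟨i, j, h1, h2⟩ := hs.cov w hw hw'
    exact ⟨i, j, (hpr i j).2 (Or.inl h1), by rw [g2 i (Pos.pr_lt h1)]; exact h2⟩
  · intro a b hab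
    obtain ⟨h1, h2, h3⟩ := hs.red a b hab
    rw [hlen, g2 a h1, g2 b h2]
    exact ⟨by omega, by omega, h3⟩

lemma Pos.pr_blue {s : Pos} {x y a b : ℕ} (ha : a < s.par.length) (hb : b < s.par.length) (i : ℕ) :
    (s.blue x y a b).pr i =
      if i = b then some a else if i = a then some b else if i = x ∨ i = y then none
      else s.pr i := by
  simp only [Pos.pr, Pos.blue, List.getD_eq_getElem?_getD, List.getElem?_set, List.length_set]
  grind

lemma Rep.blue {s : Pos} {f p q D R B} (h : Rep s f p q D R B) {x y a b : ℕ}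
    (hx : s.pr x = some a) (hy : s.pr y = some b) (hxy : x ≠ y) (hay : a ≠ y) :
    (s(f x, f y) : Edge) ∉ B ∧ f x ≠ f y ∧
    Rep (s.blue x y a b) f (jp p (f x) (f y)) (jq p q (f x) (f y)) (jD p D (f x) (f y)) R
      (insert s(f x, f y) B) := by
  have lx := Pos.pr_lt hx
  have ly := Pos.pr_lt hy
  obtain ⟨la, xD, px⟩ := h.par x a hx
  obtain ⟨lb, yD, py⟩ := h.par y b hy
  have fxy : f x ≠ f y := fun h1 => hxy (h.inj _ _ lx ly h1)
  have pxy : p (f x) ≠ f y := by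
    rw [px]; exact fun h1 => hay (h.inj _ _ la ly h1)
  have hlen : (s.blue x y a b).par.length = s.par.length := by simp [Pos.blue]
  have ppx := h.good.pp _ xD
  have ppy := h.good.pp _ yD
  have pxD := h.good.pD _ xD
  have pyD := h.good.pD _ yD
  have fab : f a ≠ f b := by grind
  refine ⟨h.good.notMem xD yD fxy pxy, fxy, h.good.join xD yD fxy pxy, ?_, h.finB.insert _, h.c4,
    ?_, ?_, ?_, ?_⟩
  · refine (h.finD.union (Set.toFinite {f x, f y})).subset ?_
    intro v hv
    simp only [jD, Set.mem_ofPred_eq] at hv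
    simp only [Set.mem_union, Set.mem_insert_iff, Set.mem_singleton_iff]
    tauto
  · rw [hlen]; exact h.inj
  · intro i j hij
    rw [hlen]
    rw [Pos.pr_blue la lb] at hij
    simp only [jD, jp, Set.mem_ofPred_eq]
    split_ifs at hij with h1 h2 h3
    · obtain rfl : a = j := by simpa using hij
      subst h1
      refine ⟨la, ?_, ?_⟩ <;> grind
    · obtain rfl : b = j := by simpa using hij
      subst h2
      refine ⟨lb, ?_, ?_⟩ <;> grind
    · have li := Pos.pr_lt hij
      obtain ⟨k1, k2, k3⟩ := h.par i j hij
      have e1 : f i ≠ f a := fun h' => h2 (h.inj _ _ li la h')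
      have e2 : f i ≠ f b := fun h' => h1 (h.inj _ _ li lb h')
      have e3 : f i ≠ f x := fun h' => h3 (Or.inl (h.inj _ _ li lx h'))
      have e4 : f i ≠ f y := fun h' => h3 (Or.inr (h.inj _ _ li ly h'))
      refine ⟨k1, ?_, ?_⟩ <;> grind
  · intro v hv hpv
    simp only [jD, jp, Set.mem_ofPred_eq] at hv hpv
    by_cases hva : v = f a
    · refine ⟨a, b, ?_, hva.symm⟩
      rw [Pos.pr_blue la lb]
      have : a ≠ b := fun h' => fab (by rw [h'])
      simp [this]
    by_cases hvb : v = f b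
    · refine ⟨b, a, ?_, hvb.symm⟩
      rw [Pos.pr_blue la lb]
      simp
    rw [px, py, if_neg hva, if_neg hvb] at hpv
    obtain ⟨i, j, hi, rfl⟩ := h.cov v (by tauto) hpv
    refine ⟨i, j, ?_, rfl⟩
    rw [Pos.pr_blue la lb]
    have e1 : i ≠ a := fun h' => hva (by rw [h'])
    have e2 : i ≠ b := fun h' => hvb (by rw [h'])
    have e3 : ¬ (i = x ∨ i = y) := by
      rintro (rfl | rfl)
      · apply hv; right; left; exact ⟨rfl, hpv⟩
      · apply hv; right; right; exact ⟨rfl, hpv⟩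
    simp [e1, e2, e3, hi]
  · intro u v huv
    rw [hlen]; exact h.red u v huv

lemma Rep.addr {s : Pos} {f p q D R B} (h : Rep s f p q D R B) {x y : ℕ} {R' : Set Edge}
    (hx : x < s.par.length) (hy : y < s.par.length) (hR : R ⊆ R') (hc : ¬ C4 R')
    (he : s(f x, f y) ∈ R') : Rep (s.addr x y) f p q D R' B := by
  refine ⟨h.good, h.finD, h.finB, hc, h.inj, h.par, h.cov, ?_⟩
  intro a b hab
  rcases List.mem_cons.1 hab with h1 | h1
  · obtain ⟨rfl, rfl⟩ := Prod.mk.inj h1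
    exact ⟨hx, hy, he⟩
  · obtain ⟨h2, h3, h4⟩ := h.red a b h1
    exact ⟨h2, h3, hR h4⟩

lemma Win.node {s : Pos} {k r x y a b : ℕ} (hx : s.pr x = some a) (hy : s.pr y = some b)
    (hxy : x ≠ y) (hay : a ≠ y) (h1 : Win (s.addr x y) (k + 1) r)
    (h2 : Win (s.blue x y a b) k (r + 1)) : Win s (k + 1) (r + 1) := by
  intro n f p q D R B hn hs hc
  obtain ⟨eB, fxy, hb⟩ := hs.blue hx hy hxy hay
  by_cases eR : s(f x, f y) ∈ R
  · exact (h1 n f p q D R B hn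
      (hs.addr (Pos.pr_lt hx) (Pos.pr_lt hy) subset_rfl hs.c4 eR) hc).mono (by omega)
  · refine Or.inr ⟨s(f x, f y), by simpa using fxy, by simp [eR, eB], ?_, ?_⟩
    · have := h2 n f _ _ _ R _ hn hb (by rw [Set.ncard_insert_of_notMem eB hs.finB]; omega)
      rwa [show k + (r + 1) = k + 1 + r by omega] at this
    · by_cases hC : C4 (insert s(f x, f y) R)
      · exact Or.inl hC
      · exact Or.inr (h1 n f p q D _ B hn (hs.addr (Pos.pr_lt hx) (Pos.pr_lt hy)
          (Set.subset_insert _ _) hC (Set.mem_insert _ _)) hc)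

lemma C4_of {R : Set Edge} {a b c d : ℕ} (h : [a, b, c, d].Nodup) (h1 : s(a, b) ∈ R)
    (h2 : s(b, c) ∈ R) (h3 : s(c, d) ∈ R) (h4 : s(a, d) ∈ R) : C4 R := by
  have hinj : Function.Injective ![a, b, c, d] := by
    simp at h
    intro i j hij
    fin_cases i <;> fin_cases j <;> simp at hij ⊢ <;> omega
  refine ⟨⟨![a, b, c, d], ?_⟩, hinj⟩
  intro i j hij
  rw [SimpleGraph.fromEdgeSet_adj]
  refine ⟨?_, fun h => hij.ne (hinj h)⟩
  rw [Sym2.eq_swap] at h4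
  have h1' := h1
  have h2' := h2
  have h3' := h3
  have h4' := h4
  rw [Sym2.eq_swap] at h1' h2' h3' h4'
  revert hij
  fin_cases i <;> fin_cases j <;> simp [SimpleGraph.cycleGraph_adj] <;>
    first | assumption | (intro _; assumption) | exact fun h => absurd h (by decide)

lemma Win.forced {s : Pos} {k r x y a b u v : ℕ} (hx : s.pr x = some a) (hy : s.pr y = some b)
    (hxy : x ≠ y) (hay : a ≠ y) (hu : u < s.par.length) (hv : v < s.par.length)
    (hnd : [x, u, v, y].Nodup) (e1 : s.adj x u = true)
    (e2 : s.adj u v = true) (e3 : s.adj v y = true)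
    (h2 : Win (s.blue x y a b) k r) : Win s (k + 1) r := by
  intro n f p q D R B hn hs hc
  obtain ⟨eB, fxy, hb⟩ := hs.blue hx hy hxy hay
  have lx := Pos.pr_lt hx
  have ly := Pos.pr_lt hy
  have hN : [f x, f u, f v, f y].Nodup := by
    have := hs.inj
    simp only [List.nodup_cons, List.mem_cons, List.not_mem_nil, not_or, or_false] at hnd ⊢
    grind
  have hC : ∀ R', R ⊆ R' → s(f x, f y) ∈ R' → C4 R' := fun R' hR' he =>
    C4_of hN (hR' (hs.adj e1)) (hR' (hs.adj e2)) (hR' (hs.adj e3)) he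
  have eR : s(f x, f y) ∉ R := fun h => hs.c4 (hC R subset_rfl h)
  have := h2 n f _ _ _ R _ hn hb (by rw [Set.ncard_insert_of_notMem eB hs.finB]; omega)
  rw [show k + 1 + r = k + r + 1 by omega]
  exact Or.inr ⟨s(f x, f y), by simpa using fxy, by simp [eR, eB], this,
    Or.inl (hC _ (Set.subset_insert _ _) (Set.mem_insert _ _))⟩

lemma Win.fin {s : Pos} {r v w : ℕ} (hv : s.pr v = some w)
    (h : ∀ i j, s.pr i = some j → j = i ∨ i = v ∨ i = w) : Win s 0 r := by
  intro n f p q D R B hn hs hc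
  obtain ⟨_, vD, pv⟩ := hs.par v w hv
  have : WinIn n 0 R B := by
    refine hs.good.done (by omega) hn vD ?_
    intro z hz hpz
    obtain ⟨i, j, hi, rfl⟩ := hs.cov z hz hpz
    rcases h i j hi with rfl | rfl | rfl
    · exact absurd (hs.par _ _ hi).2.2 hpz
    · exact Or.inl rfl
    · exact Or.inr pv.symm
  exact this.mono (by omega)

lemma Win.leaf {s t : Pos} {k r : ℕ} (h : Win t k r) (g : ℕ → ℕ)
    (hlt : ∀ i, i < t.par.length → g i < s.par.length)
    (hinj : ∀ i j, i < t.par.length → j < t.par.length → g i = g j → i = j)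
    (hpar : ∀ i j, t.pr i = some j → j < t.par.length ∧ s.pr (g i) = some (g j))
    (hcov : ∀ i j, s.pr i = some j → j = i ∨ ∃ i' j', t.pr i' = some j' ∧ g i' = i)
    (hred : ∀ a b, (a, b) ∈ t.red → a < t.par.length ∧ b < t.par.length ∧ s.adj (g a) (g b) = true) :
    Win s k r := by
  intro n f p q D R B hn hs hc
  refine h n (fun i => f (g i)) p q D R B hn
    ⟨hs.good, hs.finD, hs.finB, hs.c4, ?_, ?_, ?_, ?_⟩ hc
  · intro i j hi hj hij
    exact hinj i j hi hj (hs.inj _ _ (hlt i hi) (hlt j hj) hij)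
  · intro i j hij
    obtain ⟨h1, h2⟩ := hpar i j hij
    exact ⟨h1, (hs.par _ _ h2).2⟩
  · intro v hv hpv
    obtain ⟨i, j, hi, rfl⟩ := hs.cov v hv hpv
    rcases hcov i j hi with rfl | ⟨i', j', h1, rfl⟩
    · exact absurd (hs.par _ _ hi).2.2 hpv
    · exact ⟨i', j', h1, rfl⟩
  · intro a b hab
    obtain ⟨h1, h2, h3⟩ := hred a b hab
    exact ⟨h1, h2, hs.adj h3⟩

/-- Strategy trees for Builder. `A`: introduce a fresh vertex; `N x y t u`: select `xy`, continuing
with `t` if it is red and `u` if it is blue; `F x y u v t`: select `xy`, which cannot be red because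
of the red path `x u v y`; `L h l`: use the `h`-th known position, with label map `l`;
`E v`: the blue edges form a path with end `v`. -/
inductive T where
  | A (t : T)
  | N (x y : ℕ) (t u : T)
  | F (x y u v : ℕ) (t : T)
  | L (h : ℕ) (l : List ℕ)
  | E (v : ℕ)

/-- Position `t` sits in `s` via the label map `l`. -/
def leafOK (s t : Pos) (l : List ℕ) : Bool :=
  l.all (fun i => decide (i < s.par.length)) &&
  (decide (l.length = t.par.length) && (decide l.Nodup &&
  ((List.range t.par.length).all (fun i => match t.pr i with
    | none => false
    | some j => decide (j < t.par.length) && decide (s.pr (l.getD i 0) = some (l.getD j 0))) &&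
  ((List.range s.par.length).all (fun i => match s.pr i with
    | none => true
    | some j => decide (j = i) || decide (i ∈ l)) &&
  t.red.all (fun e => decide (e.1 < t.par.length) && (decide (e.2 < t.par.length) &&
    s.adj (l.getD e.1 0) (l.getD e.2 0)))))))

/-- `v` is an end of the only blue path. -/
def finOK (s : Pos) (v : ℕ) : Bool :=
  match s.pr v with
  | none => false
  | some w => (List.range s.par.length).all (fun i => match s.pr i with
    | none => true
    | some j => decide (j = i) || (decide (i = v) || decide (i = w)))

/-- Check a strategy tree. -/
def check (fl : Bool) (H : List (Pos × ℕ × ℕ)) : T → Pos → ℕ → ℕ → Bool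
  | .A t, s, k, r => check fl H t s.ext k r
  | .N x y t u, s, k, r =>
    match k, r with
    | k + 1, r + 1 =>
      match s.pr x, s.pr y with
      | some a, some b =>
        decide (x ≠ y) && (decide (a ≠ y) && (check fl H t (s.addr x y) (k + 1) r &&
          check fl H u (s.blue x y a b) k (r + 1)))
      | _, _ => false
    | _, _ => false
  | .F x y u v t, s, k, r =>
    match k with
    | k + 1 =>
      match s.pr x, s.pr y with
      | some a, some b =>
        decide (a ≠ y) && (decide (u < s.par.length) && (decide (v < s.par.length) &&
          (decide ([x, u, v, y].Nodup) && (s.adj x u && (s.adj u v && (s.adj v y &&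
            check fl H t (s.blue x y a b) k r))))))
      | _, _ => false
    | 0 => false
  | .L h l, s, k, r =>
    match H[h]? with
    | some (t, k', r') => decide (k' = k) && (decide (r' ≤ r) && leafOK s t l)
    | none => false
  | .E v, s, k, _ => fl && (decide (k = 0) && finOK s v)

lemma leafOK_sound {s t : Pos} {l : List ℕ} {k r : ℕ} (h : leafOK s t l = true) (hw : Win t k r) :
    Win s k r := by
  simp only [leafOK, Bool.and_eq_true, List.all_eq_true, decide_eq_true_eq, List.mem_range] at h
  obtain ⟨h1, h2, h3, h4, h5, h6⟩ := h
  have hget : ∀ i, (hi : i < t.par.length) → l.getD i 0 = l[i]'(by omega) := by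
    intro i hi
    rw [List.getD_eq_getElem _ _ (by omega)]
  refine hw.leaf (fun i => l.getD i 0) ?_ ?_ ?_ ?_ ?_
  · intro i hi
    rw [hget i hi]
    exact h1 _ (List.getElem_mem _)
  · intro i j hi hj hij
    change l.getD i 0 = l.getD j 0 at hij
    rw [hget i hi, hget j hj] at hij
    exact (List.Nodup.getElem_inj_iff h3).1 hij
  · intro i j hij
    have := h4 i (Pos.pr_lt hij)
    rw [hij] at this
    simpa using this
  · intro i j hij
    have := h5 i (Pos.pr_lt hij)
    rw [hij] at this
    simp only [Bool.or_eq_true, decide_eq_true_eq] at this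
    refine this.imp id fun hm => ?_
    obtain ⟨i', hi', rfl⟩ := List.getElem_of_mem hm
    have h7 := h4 i' (by omega)
    cases hj : t.pr i' with
    | none => rw [hj] at h7; simp at h7
    | some j' => exact ⟨i', j', hj, hget i' (by omega)⟩
  · intro a b hab
    exact h6 (a, b) hab

lemma finOK_sound {s : Pos} {v r : ℕ} (h : finOK s v = true) : Win s 0 r := by
  unfold finOK at h
  cases hv : s.pr v with
  | none => rw [hv] at h; simp at h
  | some w =>
    rw [hv] at h
    simp only [List.all_eq_true, List.mem_range] at h
    refine Win.fin hv fun i j hij => ?_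
    have := h i (Pos.pr_lt hij)
    rw [hij] at this
    simpa using this

lemma check_sound {fl : Bool} {H : List (Pos × ℕ × ℕ)} {K M : ℕ} (hK : fl = true → K = 0)
    (hH : ∀ h ∈ H, Win h.1 (K + h.2.1) (M + h.2.2)) (t : T) :
    ∀ {s : Pos} {k r : ℕ}, check fl H t s k r = true → Win s (K + k) (M + r) := by
  induction t with
  | A t ih =>
    intro s k r h
    rw [check] at h
    exact (ih h).of_ext
  | N x y t u iht ihu =>
    intro s k r h
    match k, r with
    | 0, _ => simp [check] at h
    | k + 1, 0 => simp [check] at h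
    | k + 1, r + 1 =>
      cases hx : s.pr x with
      | none => simp [check, hx] at h
      | some a =>
        cases hy : s.pr y with
        | none => simp [check, hx, hy] at h
        | some b =>
          simp only [check, hx, hy, Bool.and_eq_true, decide_eq_true_eq] at h
          obtain ⟨h1, h2, h3, h4⟩ := h
          exact Win.node hx hy h1 h2 (iht h3) (ihu h4)
  | F x y u v t ih =>
    intro s k r h
    match k with
    | 0 => simp [check] at h
    | k + 1 =>
      cases hx : s.pr x with
      | none => simp [check, hx] at h
      | some a =>
        cases hy : s.pr y with
        | none => simp [check, hx, hy] at h
        | some b =>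
          simp only [check, hx, hy, Bool.and_eq_true, decide_eq_true_eq] at h
          obtain ⟨h2, h3, h4, h5, h6, h7, h8, h9⟩ := h
          have h1 : x ≠ y := by
            rintro rfl
            simp at h5
          exact Win.forced hx hy h1 h2 h3 h4 h5 h6 h7 h8 (ih h9)
  | L h l =>
    intro s k r hc
    cases hh : H[h]? with
    | none => simp [check, hh] at hc
    | some e =>
      obtain ⟨t, k', r'⟩ := e
      simp only [check, hh, Bool.and_eq_true, decide_eq_true_eq] at hc
      obtain ⟨rfl, h2, h3⟩ := hc
      have := hH _ (List.mem_of_getElem? hh)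
      exact (leafOK_sound h3 this).mono (by simpa using h2)
  | E v =>
    intro s k r hc
    simp only [check, Bool.and_eq_true, decide_eq_true_eq] at hc
    obtain ⟨h1, rfl, h3⟩ := hc
    rw [hK h1]
    exact finOK_sound h3

/-- Check a table of strategy trees, each of which may refer to the earlier ones. -/
def checkAll : List (Pos × ℕ × ℕ) → List (Pos × ℕ × ℕ × T) → Bool
  | _, [] => true
  | H, (s, k, r, t) :: l => check true H t s k r && checkAll (H ++ [(s, k, r)]) l

lemma checkAll_sound : ∀ {l : List (Pos × ℕ × ℕ × T)} {H : List (Pos × ℕ × ℕ)},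
    (∀ h ∈ H, Win h.1 h.2.1 h.2.2) → checkAll H l = true → ∀ e ∈ l, Win e.1 e.2.1 e.2.2.1
  | [], _, _, _ => by simp
  | (s, k, r, t) :: l, H, hH, h => by
    simp only [checkAll, Bool.and_eq_true] at h
    have h1 : Win s k r := by
      have := check_sound (K := 0) (M := 0) (fun _ => rfl) (by simpa using hH) t h.1
      simpa using this
    intro e he
    rcases List.mem_cons.1 he with rfl | he
    · exact h1
    · refine checkAll_sound (H := H ++ [(s, k, r)]) ?_ h.2 e he
      intro g hg
      rcases List.mem_append.1 hg with hg | hg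
      · exact hH g hg
      · rw [List.mem_singleton.1 hg]; exact h1

/-- The empty position. -/
def pO : Pos := ⟨[], []⟩
/-- The `b`-path. -/
def pB : Pos := ⟨[], [some 1, some 0]⟩
/-- The `br`-path. -/
def pBr : Pos := ⟨[(1, 2)], [some 1, some 0, some 2]⟩
/-- The `brb`-path. -/
def pBrb : Pos := ⟨[(1, 2)], [some 1, some 0, some 3, some 2]⟩
/-- The `brr`-path. -/
def pBrr : Pos := ⟨[(1, 2), (2, 3)], [some 1, some 0, some 2, some 3]⟩
/-- The `brrb`-path. -/
def pBrrb : Pos := ⟨[(1, 2), (2, 3)], [some 1, some 0, some 2, some 4, some 3]⟩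
/-- A red path on four vertices whose ends are the ends of a blue path. -/
def pQ : Pos := ⟨[(0, 1), (1, 2), (2, 3)], [some 3, some 1, some 2, some 0]⟩

lemma win_brrb {K M : ℕ} (h0 : Win pBrrb (K + 1) (M + 1)) (h1 : Win pBrr (K + 1) M)
    (h2 : Win pBrb K (M + 1)) : Win pBrrb (K + 2) (M + 2) := by
  refine check_sound (fl := false) (H := [(pBrrb, 1, 1), (pBrr, 1, 0), (pBrb, 0, 1)]) (by simp)
    (by simpa using ⟨h0, h1, h2⟩) (.A (.N 2 5 (.N 0 5 (.F 0 3 5 2 (.L 1 [4, 1, 2, 5]))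
      (.L 0 [5, 1, 2, 3, 4])) (.N 1 5 (.F 3 5 2 1 (.L 2 [0, 1, 2, 4])) (.L 2 [0, 2, 3, 4])))) ?_
  decide +kernel

lemma win_brb {K M : ℕ} (h0 : Win pBrb (K + 1) (M + 2)) (h1 : Win pBr (K + 1) (M + 1))
    (h2 : Win pB K (M + 3)) : Win pBrb (K + 2) (M + 3) := by
  refine check_sound (fl := false) (H := [(pBrb, 1, 2), (pBr, 1, 1), (pB, 0, 3)]) (by simp)
    (by simpa using ⟨h0, h1, h2⟩) (.A (.N 1 4 (.N 0 4 (.F 0 2 4 1 (.L 1 [3, 1, 4]))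
      (.L 0 [4, 1, 2, 3])) (.N 0 2 (.L 0 [4, 0, 2, 3]) (.L 2 [3, 4])))) ?_
  decide +kernel

lemma win_brr {K M : ℕ} (h0 : Win pBrrb K (M + 1)) (h1 : Win pBrr K M) :
    Win pBrr (K + 1) (M + 1) := by
  refine check_sound (fl := false) (H := [(pBrrb, 0, 1), (pBrr, 0, 0)]) (by simp)
    (by simpa using ⟨h0, h1⟩)
    (.A (.N 3 4 (.F 1 4 2 3 (.L 1 [0, 4, 3, 2])) (.L 0 [0, 1, 2, 3, 4]))) ?_
  decide +kernel

lemma win_br {K M : ℕ} (h0 : Win pBrb K (M + 1)) (h1 : Win pBrr (K + 1) M) :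
    Win pBr (K + 1) (M + 1) := by
  refine check_sound (fl := false) (H := [(pBrb, 0, 1), (pBrr, 1, 0)]) (by simp)
    (by simpa using ⟨h0, h1⟩)
    (.A (.N 2 3 (.L 1 [0, 1, 2, 3]) (.L 0 [0, 1, 2, 3]))) ?_
  decide +kernel

lemma win_b {K M : ℕ} (h0 : Win pBr (K + 1) M) (h1 : Win pB K (M + 1)) :
    Win pB (K + 1) (M + 1) := by
  refine check_sound (fl := false) (H := [(pBr, 1, 0), (pB, 0, 1)]) (by simp)
    (by simpa using ⟨h0, h1⟩) (.A (.N 0 2 (.L 0 [1, 0, 2]) (.L 1 [2, 1]))) ?_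
  decide +kernel

lemma win_empty {K M : ℕ} (h0 : Win pB K (M + 3)) (h1 : Win pBr K (M + 2))
    (h2 : Win pBrr K (M + 1)) (h3 : Win pQ K M) : Win pO (K + 1) (M + 3) := by
  refine check_sound (fl := false) (H := [(pB, 0, 3), (pBr, 0, 2), (pBrr, 0, 1), (pQ, 0, 0)])
    (by simp) (by simpa using ⟨h0, h1, h2, h3⟩) (.A (.A (.N 0 1 (.A (.N 0 2 (.A (.N 1 3
      (.F 2 3 0 1 (.L 3 [2, 0, 1, 3])) (.L 2 [3, 1, 0, 2]))) (.L 1 [2, 0, 1]))) (.L 0 [0, 1])))) ?_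
  decide +kernel

lemma win_q {K M : ℕ} (h0 : Win pBrr K M) : Win pQ K M := by
  have := check_sound (fl := false) (H := [(pBrr, 0, 0)]) (K := K) (M := M) (by simp)
    (by simpa using h0) (.L 0 [0, 3, 2, 1]) (s := pQ) (k := 0) (r := 0) (by decide +kernel)
  simpa using this

/-- All five nonempty patterns are won. -/
def Fam (u w : ℕ) : Prop :=
  Win pBrrb u w ∧ Win pBrb u (w + 1) ∧ Win pBrr (u + 1) w ∧ Win pBr (u + 1) (w + 1) ∧
    Win pB (u + 1) (w + 2)

lemma fam_step {u w : ℕ} (h0 : Fam u w) (h1 : Fam (u + 1) (w + 1)) (hb : Win pB u (w + 3)) :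
    Fam (u + 2) (w + 2) := by
  obtain ⟨a0, a1, a2, a3, a4⟩ := h0
  obtain ⟨b0, b1, b2, b3, b4⟩ := h1
  have c0 := win_brrb b0 a2 a1
  have c1 := win_brb b1 a3 hb
  have c2 := win_brr (K := u + 2) (M := w + 1) c0 b2
  have c3 := win_br (K := u + 2) (M := w + 2) c1 c2
  have c4 := win_b (K := u + 2) (M := w + 3) c3 (b4.mono (by omega))
  exact ⟨c0, c1, c2, c3, c4⟩

lemma fam_all {u w : ℕ} (h0 : Fam u w) (h1 : Fam (u + 1) (w + 1)) (hb : Win pB u (w + 3)) (i : ℕ) :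
    Fam (u + i) (w + i) := by
  have : Fam (u + i) (w + i) ∧ Fam (u + i + 1) (w + i + 1) ∧ Win pB (u + i) (w + i + 3) := by
    induction i with
    | zero => exact ⟨h0, h1, hb⟩
    | succ i ih =>
      obtain ⟨x, y, z⟩ := ih
      refine ⟨y, fam_step x y z, ?_⟩
      exact x.2.2.2.2.mono (by omega)
  exact this.1

/-- Strategy trees for small cases. -/
def table : List (Pos × ℕ × ℕ × T) := [
    (pB, 1, 3, (.A (.N 0 2 (.N 1 2 (.A (.N 0 3 (.F 1 3 2 0 (.E 0)) (.E 3))) (.E 0)) (.E 2)))),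
    (pBr, 1, 2, (.N 0 2 (.A (.N 0 3 (.F 1 3 2 0 (.E 0)) (.E 3))) (.E 2))),
    (pBrr, 1, 2, (.L 1 [0, 1, 2])),
    (pBrb, 1, 2, (.N 0 2 (.N 0 3 (.F 1 3 2 0 (.E 0)) (.E 2)) (.E 3))),
    (pBrrb, 1, 3, (.N 0 3 (.L 3 [1, 0, 3, 4]) (.E 4))),
    (pBrr, 2, 3, (.A (.N 1 4 (.F 3 4 2 1 (.L 3 [0, 1, 4, 3])) (.L 0 [0, 4])))),
    (pBr, 2, 3, (.N 0 2 (.A (.N 0 3 (.A (.N 1 4 (.F 0 4 2 1 (.F 1 3 2 0 (.E 3))) (.N 4 2 (.F 4 3 2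
    0 (.E 0)) (.E 0)))) (.L 1 [3, 1, 2]))) (.L 0 [2, 1]))),
    (pB, 2, 4, (.A (.N 0 2 (.L 6 [1, 0, 2]) (.L 0 [2, 1])))),
    (pBrrb, 2, 3, (.A (.N 1 5 (.F 3 5 2 1 (.L 3 [0, 1, 5, 4])) (.N 0 3 (.L 3 [5, 0, 3, 4]) (.E
    4))))),
    (pBrb, 2, 4, (.N 0 2 (.A (.N 0 4 (.F 1 4 2 0 (.L 3 [4, 0, 2, 3])) (.L 3 [4, 1, 2, 3]))) (.L 0
    [3, 1]))),
    (pBrr, 3, 3, (.A (.N 0 4 (.N 0 2 (.F 1 4 2 0 (.F 4 3 0 2 (.A (.N 0 5 (.F 3 5 2 0 (.E 0)) (.E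
    5))))) (.A (.N 1 5 (.F 3 5 2 1 (.N 3 1 (.F 2 5 3 1 (.E 3)) (.E 5))) (.L 1 [5, 2, 3])))) (.L 5
    [4, 1, 2, 3])))),
    (pBr, 3, 4, (.A (.N 2 3 (.L 10 [0, 1, 2, 3]) (.L 9 [0, 1, 2, 3])))),
    (pB, 3, 5, (.A (.N 0 2 (.L 11 [1, 0, 2]) (.L 7 [2, 1])))),
    (pBrrb, 3, 3, (.N 0 3 (.A (.N 3 5 (.N 0 2 (.F 1 3 2 0 (.F 0 5 2 3 (.F 5 2 3 0 (.E 4)))) (.F 5 1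
    3 2 (.N 5 4 (.F 4 2 5 3 (.E 5)) (.E 3)))) (.N 0 4 (.N 2 5 (.F 0 5 3 2 (.F 2 4 3 0 (.E 2))) (.N
    0 2 (.F 1 4 2 0 (.E 0)) (.E 1))) (.L 1 [5, 1, 2])))) (.L 6 [4, 1, 2]))),
    (pBrb, 3, 4, (.A (.N 0 4 (.N 1 4 (.A (.N 4 5 (.A (.N 1 6 (.F 0 6 4 1 (.F 6 5 1 4 (.F 5 2 4 1
    (.E 1)))) (.N 0 3 (.F 0 2 4 1 (.F 5 3 4 0 (.E 6))) (.F 2 5 1 4 (.E 6))))) (.F 0 2 4 1 (.L 3 [5,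
    4, 1, 3])))) (.N 0 2 (.A (.N 4 5 (.N 3 5 (.F 0 3 4 5 (.F 2 5 0 4 (.E 5))) (.N 0 5 (.F 4 2 5 0
    (.E 0)) (.E 4))) (.L 3 [5, 0, 2, 3]))) (.L 0 [3, 4]))) (.L 9 [4, 1, 2, 3])))),
    (pBrr, 4, 4, (.A (.N 3 4 (.F 1 4 2 3 (.L 10 [0, 4, 3, 2])) (.L 13 [0, 1, 2, 3, 4])))),
    (pBr, 4, 5, (.A (.N 2 3 (.L 15 [0, 1, 2, 3]) (.L 14 [0, 1, 2, 3])))),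
    (pB, 4, 6, (.A (.N 0 2 (.L 16 [1, 0, 2]) (.L 12 [2, 1])))),
    (pBrrb, 4, 4, (.A (.N 1 5 (.F 3 5 2 1 (.N 0 5 (.F 0 2 5 1 (.A (.N 4 6 (.N 4 1 (.F 2 6 1 4 (.F 6
    5 4 1 (.E 4))) (.A (.N 5 7 (.F 2 7 1 5 (.E 5)) (.E 7)))) (.L 3 [6, 5, 1, 2])))) (.L 6 [4, 1,
    2]))) (.N 0 2 (.L 13 [5, 0, 2, 3, 4]) (.L 9 [4, 3, 2, 5]))))),
    (pBrb, 4, 5, (.A (.N 1 4 (.A (.N 4 5 (.F 2 5 1 4 (.L 13 [0, 1, 4, 5, 3])) (.N 0 2 (.N 0 3 (.F 0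
    4 2 1 (.A (.N 3 6 (.F 1 3 2 0 (.F 6 2 3 0 (.E 5))) (.L 3 [6, 2, 1, 5])))) (.A (.N 2 6 (.F 4 6 1
    2 (.L 3 [5, 6, 2, 1])) (.L 3 [5, 4, 1, 6])))) (.L 9 [5, 4, 1, 3])))) (.N 0 2 (.L 14 [4, 0, 2,
    3]) (.L 7 [3, 4]))))),
    (pBrr, 5, 4, (.A (.N 3 4 (.A (.N 2 5 (.N 3 5 (.F 1 3 2 5 (.F 5 4 2 3 (.A (.N 5 6 (.F 2 4 5 3
    (.F 2 6 3 5 (.F 3 6 2 5 (.E 0)))) (.N 2 6 (.F 3 6 5 2 (.F 2 4 5 3 (.E 0))) (.N 0 2 (.F 0 4 2 3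
    (.E 3)) (.E 4))))))) (.F 1 4 2 3 (.A (.N 2 6 (.A (.N 3 7 (.F 5 7 2 3 (.F 7 6 3 2 (.F 6 4 2 3
    (.E 0)))) (.N 0 5 (.F 5 4 2 3 (.F 0 6 5 2 (.E 6))) (.F 6 4 2 3 (.E 7))))) (.F 5 4 2 3 (.L 3 [0,
    3, 2, 6])))))) (.F 1 4 2 3 (.L 13 [0, 4, 3, 2, 5])))) (.L 18 [0, 1, 2, 3, 4])))),
    (pBr, 5, 5, (.A (.N 2 3 (.L 20 [0, 1, 2, 3]) (.L 19 [0, 1, 2, 3])))),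
    (pB, 5, 6, (.A (.N 0 2 (.L 21 [1, 0, 2]) (.L 17 [2, 1])))),
    (pBrrb, 5, 5, (.A (.N 2 5 (.A (.N 1 6 (.F 3 6 2 1 (.F 6 5 1 2 (.L 13 [0, 1, 2, 5, 4]))) (.N 0 3
    (.F 0 5 3 2 (.L 13 [6, 5, 2, 3, 4])) (.N 5 6 (.L 10 [4, 6, 5, 2]) (.L 6 [4, 5, 2]))))) (.N 1 5
    (.F 3 5 2 1 (.L 14 [0, 1, 2, 4])) (.L 14 [0, 2, 3, 4]))))),
    (pBrb, 5, 6, (.A (.N 1 4 (.A (.N 4 5 (.F 2 5 1 4 (.L 18 [0, 1, 4, 5, 3])) (.N 0 2 (.F 0 4 2 1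
    (.L 14 [5, 1, 2, 3])) (.L 14 [5, 4, 1, 3])))) (.N 0 2 (.L 19 [4, 0, 2, 3]) (.L 12 [3, 4]))))),
    (pBrr, 6, 5, (.A (.N 3 4 (.F 1 4 2 3 (.L 20 [0, 4, 3, 2])) (.L 23 [0, 1, 2, 3, 4])))),
    (pBr, 6, 6, (.A (.N 2 3 (.L 25 [0, 1, 2, 3]) (.L 24 [0, 1, 2, 3])))),
    (pB, 6, 7, (.A (.N 0 2 (.L 26 [1, 0, 2]) (.L 22 [2, 1])))),
    (pBrrb, 6, 6, (.A (.N 2 5 (.N 0 5 (.F 0 3 5 2 (.L 20 [4, 1, 2, 5])) (.L 23 [5, 1, 2, 3, 4]))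
    (.N 1 5 (.F 3 5 2 1 (.L 19 [0, 1, 2, 4])) (.L 19 [0, 2, 3, 4]))))),
    (pBrb, 6, 7, (.A (.N 1 4 (.N 0 4 (.F 0 2 4 1 (.L 21 [3, 1, 4])) (.L 24 [4, 1, 2, 3])) (.N 0 2
    (.L 24 [4, 0, 2, 3]) (.L 17 [3, 4]))))),
    (pBrr, 7, 6, (.A (.N 3 4 (.F 1 4 2 3 (.L 25 [0, 4, 3, 2])) (.L 28 [0, 1, 2, 3, 4])))),
    (pBr, 7, 7, (.A (.N 2 3 (.L 30 [0, 1, 2, 3]) (.L 29 [0, 1, 2, 3])))),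
    (pB, 7, 8, (.A (.N 0 2 (.L 31 [1, 0, 2]) (.L 27 [2, 1])))),
    (pBrrb, 6, 5, (.A (.N 2 5 (.A (.N 5 6 (.A (.N 2 7 (.N 5 7 (.F 1 5 2 7 (.F 2 6 7 5 (.A (.N 7 8
    (.F 7 3 5 2 (.F 7 6 2 5 (.F 2 8 5 7 (.F 8 5 7 2 (.E 0))))) (.F 3 5 2 7 (.N 0 7 (.F 0 2 7 5 (.F
    6 7 5 2 (.E 8))) (.N 6 8 (.F 2 8 5 6 (.E 6)) (.E 2)))))))) (.F 1 6 2 5 (.A (.N 7 8 (.F 7 6 2 5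
    (.N 0 8 (.F 0 2 8 7 (.F 8 3 7 2 (.F 8 5 7 2 (.E 4)))) (.N 8 4 (.F 8 3 7 2 (.F 2 4 7 8 (.E 5)))
    (.A (.N 5 9 (.F 3 9 2 5 (.E 5)) (.E 9)))))) (.A (.N 4 9 (.N 2 4 (.F 4 6 2 5 (.F 3 9 2 4 (.F 9 5
    4 2 (.E 0)))) (.N 0 3 (.F 0 5 3 2 (.F 3 6 2 5 (.E 2))) (.N 8 2 (.F 8 6 2 5 (.E 5)) (.E 5))))
    (.N 0 3 (.F 0 5 3 2 (.F 6 3 5 2 (.E 9))) (.L 3 [8, 5, 6, 9])))))))) (.F 1 6 2 5 (.N 0 3 (.F 0 5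
    3 2 (.N 7 5 (.A (.N 7 8 (.F 7 3 5 2 (.F 6 8 5 7 (.F 2 8 5 7 (.E 5)))) (.N 6 4 (.F 6 3 5 2 (.F 2
    4 5 6 (.E 5))) (.N 5 8 (.F 8 3 5 2 (.E 5)) (.E 3))))) (.A (.N 6 8 (.F 6 3 5 2 (.F 2 8 5 6 (.E
    4))) (.L 3 [8, 2, 3, 4]))))) (.L 13 [7, 2, 5, 6, 4]))))) (.A (.N 1 7 (.F 3 7 2 1 (.N 7 6 (.F 2
    6 1 7 (.N 0 2 (.A (.N 0 8 (.F 0 7 2 1 (.F 1 8 2 0 (.F 5 8 2 0 (.E 2)))) (.N 4 5 (.F 1 4 2 5 (.F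
    7 5 1 2 (.E 8))) (.N 8 2 (.F 8 7 2 1 (.E 2)) (.E 7))))) (.A (.N 5 8 (.F 5 7 2 1 (.F 1 8 2 5 (.E
    8))) (.L 3 [8, 1, 7, 4]))))) (.L 13 [0, 1, 2, 5, 4]))) (.N 0 3 (.N 0 6 (.F 2 6 3 0 (.N 2 4 (.A
    (.N 4 8 (.F 0 4 3 2 (.F 8 3 4 2 (.F 8 5 4 2 (.E 2)))) (.N 7 5 (.F 0 5 3 2 (.F 7 3 5 2 (.E 8)))
    (.N 0 8 (.F 8 2 0 3 (.E 0)) (.E 3))))) (.A (.N 5 8 (.F 0 5 3 2 (.F 8 3 5 2 (.E 8))) (.L 3 [7,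
    0, 3, 8]))))) (.L 13 [7, 5, 2, 3, 4])) (.N 7 2 (.L 13 [6, 5, 2, 7, 4]) (.L 9 [6, 5, 2,
    4]))))))) (.N 0 2 (.A (.N 0 6 (.F 1 6 2 0 (.A (.N 0 7 (.A (.N 6 8 (.F 2 8 0 6 (.F 7 8 0 6 (.N 6
    4 (.F 6 3 0 2 (.F 7 4 0 6 (.E 0))) (.F 7 3 0 2 (.E 0))))) (.N 8 2 (.F 8 7 2 0 (.N 7 4 (.F 7 3 0
    2 (.F 2 4 0 7 (.E 0))) (.N 0 5 (.F 5 3 0 2 (.E 0)) (.E 3)))) (.F 7 3 0 2 (.L 3 [5, 0, 7,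
    4]))))) (.A (.N 2 8 (.N 3 5 (.F 5 8 3 2 (.N 3 7 (.F 6 3 0 2 (.F 7 8 3 2 (.E 4))) (.F 6 8 0 2
    (.E 4)))) (.F 6 8 0 2 (.L 3 [7, 8, 2, 4]))) (.F 6 3 0 2 (.N 8 7 (.L 3 [5, 8, 7, 4]) (.E
    4)))))))) (.N 1 5 (.A (.N 1 7 (.A (.N 2 8 (.F 3 7 2 1 (.F 8 5 2 1 (.N 8 4 (.F 1 4 2 8 (.F 8 7 2
    1 (.E 6))) (.N 6 2 (.F 6 7 2 1 (.E 2)) (.E 7))))) (.N 6 5 (.F 6 7 5 1 (.N 4 5 (.F 3 5 2 1 (.F 7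
    4 1 5 (.E 8))) (.F 3 7 2 1 (.E 8)))) (.F 3 7 2 1 (.L 3 [8, 1, 7, 4]))))) (.N 6 2 (.A (.N 6 8
    (.F 3 8 2 6 (.N 4 5 (.F 6 5 2 1 (.F 2 4 1 5 (.E 8))) (.N 7 2 (.F 7 8 2 6 (.E 6)) (.E 6)))) (.N
    8 5 (.F 8 2 5 1 (.F 3 5 2 1 (.E 7))) (.L 3 [7, 2, 3, 4])))) (.F 3 5 2 1 (.L 0 [7, 4]))))) (.L
    14 [6, 2, 3, 4])))) (.A (.N 1 6 (.F 3 6 2 1 (.L 14 [5, 1, 6, 4])) (.N 5 4 (.L 14 [6, 5, 4, 3])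
    (.L 7 [3, 6])))))))),
    (pBrb, 6, 6, (.A (.A (.N 4 5 (.A (.N 4 6 (.A (.N 5 7 (.F 6 7 4 5 (.N 1 4 (.A (.N 4 8 (.N 1 5
    (.F 1 8 5 4 (.F 2 4 1 5 (.F 4 7 1 5 (.F 8 5 4 1 (.F 6 5 4 1 (.E 0)))))) (.F 7 8 5 4 (.A (.N 6 9
    (.F 2 6 1 4 (.F 9 8 6 4 (.F 9 5 6 4 (.E 0)))) (.N 3 5 (.F 2 5 1 4 (.F 8 3 4 5 (.E 0))) (.F 2 8
    1 4 (.E 0))))))) (.F 1 7 4 5 (.N 6 8 (.F 5 8 4 6 (.N 3 5 (.F 2 5 1 4 (.F 6 3 4 5 (.E 0))) (.F 2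
    6 1 4 (.E 0)))) (.F 2 5 1 4 (.L 3 [0, 4, 5, 3])))))) (.N 2 6 (.A (.N 7 8 (.N 6 8 (.F 7 2 8 6
    (.F 8 4 7 5 (.F 8 5 6 4 (.F 5 6 7 8 (.E 0))))) (.F 2 5 6 4 (.N 0 8 (.F 0 5 8 7 (.F 8 4 7 5 (.E
    3))) (.N 7 3 (.F 4 3 5 7 (.E 5)) (.E 5))))) (.N 0 6 (.F 0 5 6 4 (.N 3 5 (.F 6 3 4 5 (.F 2 5 6 4
    (.E 4))) (.N 8 2 (.F 8 4 2 6 (.E 6)) (.E 6)))) (.F 2 5 6 4 (.L 3 [8, 4, 5, 3]))))) (.L 13 [0,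
    4, 5, 7, 3])))) (.N 1 6 (.F 2 4 1 6 (.N 0 5 (.F 0 6 5 4 (.N 6 3 (.A (.N 3 8 (.F 3 5 6 4 (.F 1 8
    6 3 (.F 8 4 3 6 (.E 6)))) (.N 1 7 (.F 1 5 6 4 (.F 7 4 1 6 (.E 6))) (.N 6 8 (.F 5 8 4 6 (.E 6))
    (.E 4))))) (.A (.N 1 8 (.F 1 5 6 4 (.F 8 4 1 6 (.E 8))) (.L 3 [8, 4, 5, 7]))))) (.L 13 [7, 1,
    6, 4, 3]))) (.N 2 5 (.N 0 2 (.F 0 4 2 5 (.N 7 4 (.A (.N 7 8 (.F 7 2 4 5 (.F 6 8 4 7 (.F 5 8 4 7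
    (.E 4)))) (.N 6 3 (.F 6 2 4 5 (.F 5 3 4 6 (.E 4))) (.N 8 2 (.F 8 4 2 5 (.E 5)) (.E 5))))) (.A
    (.N 6 8 (.F 6 2 4 5 (.F 5 8 4 6 (.E 8))) (.L 3 [8, 5, 2, 3]))))) (.L 13 [7, 5, 4, 6, 3])) (.N 7
    4 (.L 13 [0, 6, 4, 7, 3]) (.L 9 [0, 6, 4, 3])))))) (.N 1 5 (.N 0 2 (.F 0 5 2 1 (.A (.N 1 7 (.A
    (.N 2 8 (.F 5 8 1 2 (.F 7 8 1 2 (.N 6 2 (.F 6 7 2 1 (.F 2 4 1 5 (.E 3))) (.F 7 4 1 5 (.E 3)))))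
    (.N 8 7 (.F 4 7 5 1 (.N 3 5 (.F 8 5 7 1 (.F 3 7 5 1 (.E 6))) (.N 6 1 (.F 6 8 1 7 (.E 7)) (.E
    7)))) (.N 6 7 (.F 6 5 7 1 (.F 7 4 1 5 (.E 3))) (.L 3 [1, 5, 4, 3]))))) (.A (.N 5 8 (.N 4 7 (.F
    7 8 4 5 (.N 3 4 (.F 2 4 1 5 (.F 8 3 5 4 (.E 6))) (.F 2 8 1 5 (.E 6)))) (.F 2 8 1 5 (.L 3 [6, 5,
    8, 3]))) (.F 2 4 1 5 (.N 6 8 (.L 3 [7, 8, 6, 3]) (.E 3)))))))) (.L 18 [6, 4, 5, 1, 3])) (.N 0 4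
    (.N 0 2 (.A (.N 4 7 (.A (.N 0 8 (.F 2 7 0 4 (.F 8 5 0 4 (.N 8 3 (.F 8 7 0 4 (.F 3 4 8 0 (.E
    0))) (.N 0 6 (.F 6 7 0 4 (.E 0)) (.E 4))))) (.N 6 5 (.F 6 7 5 4 (.N 3 5 (.F 2 5 0 4 (.F 7 3 4 5
    (.E 4))) (.F 2 7 0 4 (.E 4)))) (.F 2 7 0 4 (.L 3 [8, 4, 7, 3]))))) (.N 0 6 (.A (.N 6 8 (.F 2 8
    0 6 (.N 3 5 (.F 0 3 4 5 (.F 6 5 0 4 (.E 7))) (.N 0 7 (.F 8 7 6 0 (.E 0)) (.E 8)))) (.N 8 5 (.F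
    0 8 4 5 (.F 2 5 0 4 (.E 3))) (.L 3 [7, 0, 2, 3])))) (.F 2 5 0 4 (.L 0 [3, 7]))))) (.L 14 [6, 4,
    5, 3])) (.N 5 2 (.L 14 [6, 5, 2, 3]) (.L 7 [3, 6])))))) (.N 0 2 (.N 0 4 (.A (.N 5 6 (.N 0 6 (.A
    (.N 6 7 (.F 1 6 2 0 (.A (.N 5 8 (.F 2 5 0 6 (.F 0 8 6 5 (.F 7 8 6 5 (.F 7 4 6 0 (.E 6))))) (.N
    2 8 (.F 8 6 2 0 (.F 7 2 6 0 (.F 7 4 6 0 (.E 0)))) (.N 7 3 (.F 0 3 6 7 (.F 7 4 6 0 (.E 6))) (.N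
    0 7 (.F 6 4 7 0 (.E 0)) (.E 4))))))) (.A (.N 4 8 (.F 1 4 2 0 (.F 8 2 4 0 (.F 8 6 4 0 (.N 0 7
    (.F 7 5 0 6 (.E 0)) (.E 5))))) (.F 1 6 2 0 (.N 3 5 (.F 0 3 6 5 (.F 2 5 0 6 (.E 8))) (.L 3 [7,
    0, 2, 8]))))))) (.A (.N 2 7 (.A (.N 7 8 (.F 4 7 0 2 (.N 8 5 (.F 2 5 7 8 (.F 7 6 8 5 (.F 8 1 7 2
    (.E 8)))) (.N 8 6 (.F 8 1 7 2 (.F 6 2 8 7 (.E 7))) (.N 7 3 (.F 1 3 2 7 (.E 7)) (.E 2))))) (.N 1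
    3 (.F 1 4 2 0 (.N 2 5 (.F 3 5 1 2 (.F 6 7 5 2 (.E 8))) (.F 3 7 1 2 (.E 8)))) (.F 7 4 2 0 (.L 3
    [8, 5, 6, 2]))))) (.F 1 4 2 0 (.N 5 7 (.A (.N 6 8 (.N 3 8 (.F 5 3 6 8 (.F 7 8 5 6 (.E 8))) (.N
    5 8 (.F 7 6 5 8 (.E 5)) (.E 7))) (.L 3 [8, 5, 7, 3]))) (.L 0 [3, 6])))))) (.F 1 4 2 0 (.L 14
    [6, 0, 2, 3])))) (.L 19 [5, 1, 2, 3])) (.N 5 1 (.L 19 [4, 5, 1, 3]) (.L 12 [3, 4]))))))),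
    (pBrrb, 7, 7, (.N 0 2 (.A (.N 0 5 (.F 1 5 2 0 (.L 33 [5, 0, 2, 3, 4])) (.L 28 [5, 1, 2, 3,
    4]))) (.L 29 [4, 3, 2, 1]))),
    (pBrb, 7, 8, (.N 0 2 (.A (.N 0 4 (.F 1 4 2 0 (.L 34 [4, 0, 2, 3])) (.L 29 [4, 1, 2, 3]))) (.L
    27 [3, 1]))),
    (pBrr, 8, 7, (.A (.N 3 4 (.F 1 4 2 3 (.L 30 [0, 4, 3, 2])) (.L 35 [0, 1, 2, 3, 4])))),
    (pBr, 8, 8, (.A (.N 2 3 (.L 37 [0, 1, 2, 3]) (.L 36 [0, 1, 2, 3])))),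
    (pB, 8, 9, (.A (.N 0 2 (.L 38 [1, 0, 2]) (.L 32 [2, 1])))),
    (pBrrb, 7, 6, (.N 0 2 (.A (.N 0 5 (.A (.N 0 6 (.A (.N 5 7 (.F 1 5 2 0 (.F 7 2 5 0 (.F 7 6 5 0
    (.A (.N 2 8 (.F 6 8 0 2 (.A (.N 8 9 (.F 8 5 2 0 (.F 0 9 2 8 (.F 9 3 8 2 (.E 4)))) (.N 4 5 (.F 2
    4 0 5 (.F 3 5 2 0 (.E 0))) (.N 0 9 (.F 9 3 0 2 (.E 0)) (.E 3)))))) (.A (.N 4 9 (.N 6 9 (.F 0 4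
    6 9 (.F 6 3 0 2 (.F 5 9 0 6 (.E 9)))) (.N 0 9 (.F 9 3 0 2 (.F 5 4 0 9 (.E 0))) (.F 3 5 2 0 (.E
    4)))) (.F 3 5 2 0 (.L 3 [8, 6, 0, 9]))))))))) (.F 1 6 2 0 (.A (.N 6 8 (.F 5 8 0 6 (.F 2 8 0 6
    (.N 0 7 (.A (.N 7 9 (.F 7 3 0 2 (.F 2 9 0 7 (.F 6 9 0 7 (.E 0)))) (.N 4 6 (.F 2 4 0 6 (.F 3 6 2
    0 (.E 0))) (.N 0 9 (.F 9 3 0 2 (.E 0)) (.E 3))))) (.A (.N 6 9 (.F 6 3 0 2 (.F 2 9 0 6 (.E 4)))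
    (.L 3 [9, 2, 3, 4])))))) (.N 4 5 (.F 2 4 0 5 (.N 2 8 (.A (.N 8 9 (.F 8 5 2 0 (.F 0 9 2 8 (.F 9
    3 8 2 (.E 2)))) (.N 7 3 (.F 0 7 2 3 (.F 5 3 0 2 (.E 9))) (.N 5 9 (.F 2 9 0 5 (.E 0)) (.E 0)))))
    (.A (.N 3 9 (.F 3 5 2 0 (.F 0 9 2 3 (.E 9))) (.L 3 [7, 5, 0, 9]))))) (.L 13 [7, 3, 2, 0,
    8]))))))) (.A (.A (.N 7 8 (.N 2 7 (.F 1 8 2 7 (.A (.N 2 9 (.F 5 9 0 2 (.A (.N 9 10 (.F 8 9 7 2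
    (.F 10 3 9 2 (.F 10 7 9 2 (.F 7 5 2 0 (.E 6))))) (.N 3 6 (.F 8 3 7 2 (.F 5 7 0 2 (.F 7 6 2 3
    (.E 4)))) (.N 2 10 (.F 8 10 7 2 (.F 7 5 2 0 (.E 4))) (.N 8 2 (.F 8 5 2 0 (.E 4)) (.E 5)))))))
    (.F 5 7 0 2 (.N 2 4 (.F 8 3 7 2 (.N 5 6 (.F 2 6 0 5 (.F 4 5 2 0 (.E 7))) (.N 4 9 (.F 9 7 4 2
    (.E 4)) (.E 7)))) (.F 3 5 2 0 (.L 3 [6, 8, 7, 9]))))))) (.F 1 5 2 0 (.N 8 2 (.F 8 5 2 0 (.N 7 6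
    (.A (.N 3 9 (.F 7 3 8 2 (.F 2 6 8 7 (.F 9 8 3 2 (.E 9)))) (.N 2 9 (.F 7 9 8 2 (.F 2 6 8 7 (.E
    4))) (.N 8 4 (.F 6 4 7 8 (.E 7)) (.E 7))))) (.A (.N 4 9 (.N 4 2 (.F 8 9 2 4 (.F 9 3 4 2 (.E
    4))) (.A (.N 3 10 (.F 8 10 2 3 (.E 3)) (.E 10)))) (.L 3 [9, 3, 2, 8]))))) (.F 3 5 2 0 (.N 7 6
    (.A (.N 8 9 (.N 4 9 (.F 7 4 8 9 (.F 6 9 7 8 (.E 9))) (.N 7 9 (.F 8 6 9 7 (.E 7)) (.E 8))) (.L 3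
    [9, 7, 6, 4]))) (.L 0 [4, 8])))))) (.F 1 5 2 0 (.N 8 5 (.F 8 2 5 0 (.A (.N 2 9 (.N 7 3 (.F 7 9
    3 2 (.N 9 6 (.F 9 5 2 0 (.F 6 3 9 2 (.E 4))) (.F 5 3 0 2 (.E 4)))) (.F 9 5 2 0 (.L 3 [4, 2, 9,
    6]))) (.F 3 5 2 0 (.N 9 6 (.L 3 [7, 9, 6, 4]) (.E 4)))))) (.N 6 2 (.L 13 [7, 6, 2, 3, 4]) (.L 9
    [4, 3, 2, 7]))))))))) (.L 33 [5, 1, 2, 3, 4]))) (.L 34 [4, 3, 2, 1]))),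
    (pBrr, 8, 6, (.A (.N 3 4 (.A (.N 2 5 (.A (.N 3 6 (.A (.N 4 7 (.F 2 7 3 4 (.F 5 6 2 3 (.A (.N 4
    8 (.F 1 4 2 3 (.F 4 5 3 2 (.A (.N 8 9 (.F 8 2 4 3 (.F 8 6 4 3 (.F 9 7 8 4 (.F 9 3 8 4 (.E
    0))))) (.N 0 7 (.F 8 2 4 3 (.F 6 7 3 4 (.F 0 3 7 4 (.E 3)))) (.A (.N 2 10 (.F 8 2 4 3 (.F 10 6
    2 3 (.E 9))) (.F 8 6 4 3 (.E 9))))))))) (.F 6 7 3 4 (.N 5 8 (.F 3 8 2 5 (.A (.N 5 9 (.F 4 5 3 2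
    (.F 1 9 2 5 (.F 3 9 2 5 (.E 0)))) (.N 0 4 (.F 0 2 4 3 (.F 1 4 2 3 (.E 9))) (.N 9 1 (.F 9 3 1 2
    (.E 2)) (.E 3)))))) (.A (.N 3 9 (.A (.N 2 10 (.F 1 9 2 3 (.F 10 4 2 3 (.F 10 9 2 3 (.E 0))))
    (.N 0 4 (.F 1 4 2 3 (.F 0 9 4 3 (.E 10))) (.F 1 9 2 3 (.E 10))))) (.F 1 4 2 3 (.L 3 [0, 2, 3,
    9])))))))))) (.F 1 6 2 3 (.A (.N 2 8 (.N 3 5 (.F 2 4 5 3 (.F 3 8 5 2 (.A (.N 5 9 (.F 2 9 3 5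
    (.F 3 9 2 5 (.F 8 5 2 3 (.F 6 5 3 2 (.E 0))))) (.F 2 6 5 3 (.N 0 5 (.F 0 3 5 2 (.F 8 5 2 3 (.E
    9))) (.N 9 3 (.F 9 8 3 2 (.E 7)) (.E 7)))))))) (.F 4 8 3 2 (.A (.N 5 9 (.F 3 9 2 5 (.N 7 9 (.F
    8 9 2 5 (.F 5 6 2 3 (.F 7 2 9 5 (.E 0)))) (.A (.N 8 10 (.F 6 8 3 2 (.F 10 5 8 2 (.E 0))) (.F 6
    5 3 2 (.E 0)))))) (.A (.N 7 10 (.N 7 2 (.F 7 6 2 3 (.F 3 10 2 7 (.F 10 8 7 2 (.E 0)))) (.N 0 8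
    (.F 0 3 8 2 (.F 6 8 3 2 (.E 9))) (.N 9 6 (.F 9 2 6 3 (.E 3)) (.E 3)))) (.N 0 8 (.F 0 3 8 2 (.F
    6 8 3 2 (.E 9))) (.L 3 [10, 6, 3, 9])))))))) (.F 4 5 3 2 (.N 0 5 (.F 0 3 5 2 (.N 3 8 (.A (.N 8
    9 (.F 8 5 3 2 (.F 6 9 3 8 (.F 9 2 8 3 (.E 3)))) (.N 6 7 (.F 6 5 3 2 (.F 7 2 6 3 (.E 9))) (.N 5
    9 (.F 9 3 5 2 (.E 5)) (.E 3))))) (.A (.N 6 9 (.F 6 5 3 2 (.F 2 9 3 6 (.E 9))) (.L 3 [9, 2, 5,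
    7]))))) (.L 13 [7, 6, 3, 2, 8])))))))) (.F 1 4 2 3 (.A (.N 5 7 (.F 4 5 3 2 (.A (.N 7 8 (.F 2 8
    5 7 (.A (.N 8 9 (.N 2 9 (.F 3 8 2 9 (.F 2 7 9 8 (.F 9 7 2 5 (.F 9 5 8 7 (.E 0))))) (.F 3 7 2 5
    (.N 0 9 (.F 0 7 9 8 (.F 5 9 7 8 (.E 8))) (.N 5 6 (.F 6 8 5 7 (.E 5)) (.E 8))))) (.N 0 2 (.F 0 7
    2 5 (.N 6 7 (.F 6 2 7 5 (.F 3 7 2 5 (.E 9))) (.N 9 5 (.F 9 3 5 2 (.E 2)) (.E 3)))) (.F 3 7 2 5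
    (.L 3 [9, 5, 7, 6])))))) (.N 6 7 (.F 6 2 7 5 (.N 0 2 (.A (.N 0 9 (.F 0 7 2 5 (.F 3 9 2 0 (.F 5
    9 2 0 (.E 2)))) (.N 8 3 (.F 8 5 3 2 (.F 3 7 2 5 (.E 9))) (.N 9 2 (.F 9 7 2 5 (.E 2)) (.E 7)))))
    (.A (.N 3 9 (.F 3 7 2 5 (.F 5 9 2 3 (.E 9))) (.L 3 [8, 7, 5, 9]))))) (.L 13 [0, 5, 2, 3,
    8]))))) (.N 4 7 (.F 2 7 3 4 (.A (.N 2 8 (.A (.N 3 9 (.F 4 8 3 2 (.F 9 8 3 2 (.N 0 5 (.F 0 3 5 2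
    (.F 5 9 2 3 (.E 2))) (.N 9 6 (.F 6 2 9 3 (.E 9)) (.E 3))))) (.N 6 5 (.F 6 8 5 2 (.N 0 5 (.F 0 8
    5 2 (.F 5 4 2 3 (.E 2))) (.F 8 4 2 3 (.E 2)))) (.F 4 8 3 2 (.L 3 [0, 8, 2, 9]))))) (.A (.N 3 9
    (.N 6 4 (.F 6 9 4 3 (.N 9 8 (.F 9 5 3 2 (.F 8 4 9 3 (.E 0))) (.F 5 4 2 3 (.E 0)))) (.F 9 5 3 2
    (.L 3 [0, 3, 9, 8]))) (.F 4 5 3 2 (.N 0 6 (.L 3 [9, 6, 0, 8]) (.E 8)))))))) (.L 18 [0, 5, 2, 3,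
    6]))))))) (.F 1 4 2 3 (.L 33 [0, 4, 3, 2, 5])))) (.L 40 [0, 1, 2, 3, 4])))),
    (pBrb, 7, 7, (.A (.N 1 4 (.A (.N 4 5 (.F 2 5 1 4 (.L 33 [0, 1, 4, 5, 3])) (.N 0 2 (.A (.N 2 6
    (.A (.N 0 7 (.F 6 7 2 0 (.A (.N 0 8 (.F 0 4 2 1 (.F 8 6 0 2 (.A (.N 8 9 (.F 1 8 2 0 (.F 9 2 8 0
    (.F 9 7 8 0 (.E 3)))) (.N 5 7 (.F 1 7 2 0 (.F 2 5 0 7 (.E 9))) (.L 3 [9, 1, 2, 3])))))) (.F 1 7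
    2 0 (.A (.N 2 9 (.N 3 6 (.F 3 9 6 2 (.N 9 5 (.F 9 4 2 1 (.F 6 5 2 9 (.E 8))) (.F 6 4 2 1 (.E
    8)))) (.F 9 4 2 1 (.L 3 [8, 2, 9, 5]))) (.F 4 6 1 2 (.N 8 9 (.L 3 [5, 8, 9, 3]) (.E 3)))))))))
    (.N 1 3 (.F 3 6 1 2 (.A (.A (.N 8 9 (.N 1 8 (.F 2 9 1 8 (.F 6 8 2 1 (.N 9 5 (.F 1 5 8 9 (.F 9 4
    8 1 (.E 7))) (.N 7 4 (.F 7 8 4 1 (.E 4)) (.E 8))))) (.N 2 9 (.F 4 9 1 2 (.N 7 6 (.F 7 9 6 2 (.F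
    6 8 2 9 (.E 5))) (.N 5 2 (.F 5 8 2 9 (.E 2)) (.E 8)))) (.F 6 4 2 1 (.L 3 [7, 8, 9, 5])))) (.N 6
    5 (.F 6 4 2 1 (.N 9 5 (.F 1 5 2 6 (.F 2 9 6 5 (.E 7))) (.L 3 [7, 1, 2, 8]))) (.N 2 9 (.F 9 4 2
    1 (.L 3 [7, 1, 2, 8])) (.L 3 [7, 1, 4, 8]))))))) (.F 6 4 2 1 (.L 14 [7, 2, 6, 5]))))) (.A (.N 1
    7 (.F 0 7 2 1 (.N 7 6 (.A (.N 7 8 (.A (.N 6 9 (.F 1 9 7 6 (.F 8 9 7 6 (.N 6 5 (.F 6 4 7 1 (.F 8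
    5 7 6 (.E 7))) (.F 8 4 7 1 (.E 7))))) (.N 9 8 (.F 4 8 1 7 (.N 1 3 (.F 1 9 7 8 (.F 3 8 1 7 (.E
    7))) (.N 7 5 (.F 5 9 7 8 (.E 7)) (.E 8)))) (.N 8 5 (.F 1 5 7 8 (.F 8 4 7 1 (.E 7))) (.L 3 [7,
    1, 4, 3]))))) (.A (.N 1 9 (.N 4 8 (.F 8 9 4 1 (.N 3 4 (.F 6 4 7 1 (.F 9 3 1 4 (.E 5))) (.F 6 9
    7 1 (.E 5)))) (.F 6 9 7 1 (.L 3 [5, 1, 9, 3]))) (.F 6 4 7 1 (.N 9 5 (.L 3 [8, 9, 5, 3]) (.E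
    3))))))) (.L 14 [5, 4, 1, 3]))) (.F 0 4 2 1 (.N 7 6 (.L 14 [5, 7, 6, 3]) (.L 7 [3, 5])))))))
    (.L 24 [5, 4, 1, 3])))) (.N 0 2 (.L 34 [4, 0, 2, 3]) (.L 22 [3, 4]))))),
    (pBr, 8, 7, (.A (.N 2 3 (.L 41 [0, 1, 2, 3]) (.L 42 [0, 1, 2, 3])))),
    (pB, 8, 8, (.A (.N 0 2 (.L 43 [1, 0, 2]) (.L 32 [2, 1])))),
    (pBrrb, 8, 7, (.A (.N 2 5 (.A (.N 1 6 (.F 3 6 2 1 (.F 6 5 1 2 (.L 33 [0, 1, 2, 5, 4]))) (.N 0 3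
    (.F 0 5 3 2 (.L 33 [6, 5, 2, 3, 4])) (.N 5 6 (.L 25 [4, 6, 5, 2]) (.L 21 [4, 5, 2]))))) (.N 1 5
    (.F 3 5 2 1 (.L 34 [0, 1, 2, 4])) (.L 29 [0, 2, 3, 4]))))),
    (pBrb, 8, 8, (.A (.N 1 4 (.A (.N 4 5 (.F 2 5 1 4 (.L 40 [0, 1, 4, 5, 3])) (.N 0 2 (.F 0 4 2 1
    (.L 34 [5, 1, 2, 3])) (.L 29 [5, 4, 1, 3])))) (.N 0 2 (.L 42 [4, 0, 2, 3]) (.L 27 [3, 4]))))),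
    (pBrr, 9, 7, (.A (.N 3 4 (.F 1 4 2 3 (.L 41 [0, 4, 3, 2])) (.L 45 [0, 1, 2, 3, 4])))),
    (pBr, 9, 8, (.A (.N 2 3 (.L 47 [0, 1, 2, 3]) (.L 46 [0, 1, 2, 3])))),
    (pB, 9, 9, (.A (.N 0 2 (.L 48 [1, 0, 2]) (.L 44 [2, 1])))),
    (pQ, 6, 4, (.A (.N 0 4 (.F 2 4 1 0 (.A (.N 3 5 (.A (.N 2 6 (.F 1 5 2 3 (.F 5 6 3 2 (.A (.N 1 7
    (.F 0 6 1 2 (.F 3 7 2 1 (.F 7 4 1 0 (.E 2)))) (.N 3 4 (.F 0 2 4 3 (.F 4 6 3 2 (.E 3))) (.F 0 6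
    1 2 (.E 7))))))) (.A (.N 1 7 (.F 4 7 0 1 (.F 1 5 2 3 (.N 0 5 (.F 1 3 0 5 (.F 7 5 1 0 (.E 0)))
    (.F 3 7 2 1 (.E 6))))) (.N 3 7 (.N 0 5 (.F 0 7 5 3 (.F 3 4 5 0 (.F 1 5 2 3 (.E 6)))) (.N 1 3
    (.F 1 5 2 3 (.F 3 4 1 0 (.E 6))) (.N 4 5 (.F 4 7 5 3 (.E 5)) (.E 7)))) (.F 1 5 2 3 (.L 3 [5, 0,
    4, 6]))))))) (.A (.N 4 6 (.F 1 6 0 4 (.A (.N 0 7 (.F 2 7 1 0 (.F 7 6 0 4 (.N 1 5 (.F 4 5 0 1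
    (.E 0)) (.E 0)))) (.N 1 5 (.N 2 6 (.F 1 4 2 6 (.F 5 6 1 2 (.E 2))) (.F 5 4 1 0 (.E 7))) (.L 3
    [2, 4, 6, 7]))))) (.L 13 [5, 0, 1, 2, 6])))))) (.L 20 [4, 3, 2, 1])))),
    (pQ, 7, 5, (.A (.N 0 4 (.F 2 4 1 0 (.A (.N 3 5 (.A (.N 2 6 (.F 1 5 2 3 (.F 5 6 3 2 (.A (.N 0 7
    (.F 0 6 1 2 (.F 2 7 1 0 (.A (.N 1 8 (.F 3 8 2 1 (.F 8 7 1 0 (.E 1))) (.N 3 4 (.F 3 7 4 0 (.E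
    4)) (.E 7)))))) (.A (.N 6 8 (.F 1 8 2 6 (.N 7 8 (.F 2 7 6 8 (.F 3 8 2 6 (.E 6))) (.N 3 4 (.F 4
    6 3 2 (.E 2)) (.E 6)))) (.N 3 4 (.F 1 3 0 4 (.N 2 8 (.F 4 8 3 2 (.E 2)) (.E 4))) (.L 3 [8, 1,
    2, 7])))))))) (.A (.N 4 7 (.F 1 5 2 3 (.A (.N 5 8 (.N 7 8 (.F 4 5 7 8 (.F 0 8 4 7 (.F 1 7 0 4
    (.F 3 7 5 8 (.E 6))))) (.N 0 5 (.F 1 3 0 5 (.F 4 8 0 5 (.F 5 7 0 4 (.E 0)))) (.F 1 7 0 4 (.N 3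
    4 (.F 4 8 3 5 (.E 3)) (.E 8))))) (.N 0 6 (.F 6 7 0 4 (.N 8 7 (.F 0 8 4 7 (.F 1 7 0 4 (.E 3)))
    (.N 1 3 (.F 3 4 1 0 (.E 0)) (.E 0)))) (.F 1 7 0 4 (.L 3 [3, 4, 7, 8])))))) (.A (.N 1 8 (.F 1 5
    2 3 (.N 0 7 (.F 7 8 0 1 (.N 0 5 (.F 1 3 0 5 (.F 8 5 1 0 (.E 0))) (.F 3 8 2 1 (.E 6)))) (.F 8 3
    1 2 (.L 3 [6, 8, 1, 5])))) (.N 3 7 (.N 0 7 (.F 0 5 7 3 (.N 7 8 (.F 1 7 2 3 (.F 5 8 3 7 (.E 3)))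
    (.F 1 3 0 7 (.E 5)))) (.F 1 5 2 3 (.L 3 [8, 5, 3, 6]))) (.F 1 5 2 3 (.N 0 8 (.L 3 [5, 8, 0, 6])
    (.E 6)))))))))) (.A (.N 4 6 (.F 1 6 0 4 (.A (.N 1 7 (.F 4 7 0 1 (.A (.N 2 8 (.F 7 8 1 2 (.N 5 8
    (.F 0 8 1 2 (.F 1 5 2 8 (.E 2))) (.N 0 6 (.F 2 6 1 0 (.E 0)) (.E 2)))) (.N 6 7 (.F 0 7 4 6 (.N
    1 8 (.F 8 6 1 7 (.E 1)) (.E 5))) (.L 3 [8, 1, 0, 5]))))) (.A (.N 2 8 (.N 2 5 (.N 4 8 (.F 2 6 8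
    4 (.F 5 4 2 8 (.F 0 8 1 2 (.E 7)))) (.N 0 2 (.F 0 8 1 2 (.F 2 6 0 4 (.E 5))) (.N 5 6 (.F 6 8 5
    2 (.E 5)) (.E 7)))) (.F 0 8 1 2 (.L 3 [8, 4, 6, 7]))) (.N 0 8 (.F 8 6 0 4 (.L 3 [7, 4, 0, 5]))
    (.L 3 [7, 6, 4, 5]))))))) (.L 18 [5, 0, 1, 2, 6])))))) (.L 25 [4, 3, 2, 1]))))]

lemma table_ok : checkAll [] table = true := by
  decide +kernel

lemma table_win (i : ℕ) (hi : i < table.length) :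
    Win table[i].1 table[i].2.1 table[i].2.2.1 :=
  checkAll_sound (by simp) table_ok _ (List.getElem_mem hi)

lemma fam_zero (i : ℕ) : Fam (4 + i) (4 + i) := by
  refine fam_all ?_ ?_ ?_ i
  · exact ⟨table_win 18 (by decide), table_win 19 (by decide), table_win 20 (by decide),
      table_win 21 (by decide), table_win 22 (by decide)⟩
  · exact ⟨table_win 23 (by decide), table_win 24 (by decide), table_win 25 (by decide),
      table_win 26 (by decide), table_win 27 (by decide)⟩
  · exact Win.mono (r := 6) (table_win 17 (by decide)) (by decide)

lemma fam_neg (i : ℕ) : Fam (7 + i) (6 + i) := by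
  refine fam_all ?_ ?_ ?_ i
  · exact ⟨table_win 40 (by decide), table_win 42 (by decide), table_win 41 (by decide),
      table_win 43 (by decide), table_win 44 (by decide)⟩
  · exact ⟨table_win 45 (by decide), table_win 46 (by decide), table_win 47 (by decide),
      table_win 48 (by decide), table_win 49 (by decide)⟩
  · exact Win.mono (r := 8) (table_win 32 (by decide)) (by decide)

lemma q_all (i : ℕ) : Win pQ (6 + i) (4 + i) := by
  match i with
  | 0 => exact table_win 50 (by decide)
  | 1 => exact table_win 51 (by decide)
  | i + 2 =>
    apply win_q
    have := (fam_neg i).2.2.1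
    rwa [show 7 + i + 1 = 6 + (i + 2) by omega, show 6 + i = 4 + (i + 2) by omega] at this

/-! ### Starting positions -/

/-- The position with `m` labels and no blue edges. -/
def bare (red : List (ℕ × ℕ)) (m : ℕ) : Pos := ⟨red, (List.range m).map some⟩

lemma rep_bare {red : List (ℕ × ℕ)} {m : ℕ} {R : Set Edge} (hR : ¬ C4 R)
    (hr : ∀ a b, (a, b) ∈ red → a < m ∧ b < m ∧ s(a, b) ∈ R) :
    Rep (bare red m) id id (fun v => [v]) ∅ R ∅ := by
  have hlen : (bare red m).par.length = m := by simp [bare]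
  refine ⟨good_empty, Set.finite_empty, Set.finite_empty, hR, fun _ _ _ _ h => h, ?_, ?_, ?_⟩
  · intro i j hij
    have hi := Pos.pr_lt hij
    rw [hlen] at hi
    have : (bare red m).pr i = some i := by
      simp [Pos.pr, bare, hi]
    rw [this] at hij
    obtain rfl : i = j := by simpa using hij
    rw [hlen]
    exact ⟨hi, by simp, rfl⟩
  · intro v _ hv
    exact absurd rfl hv
  · rw [hlen]
    exact hr

lemma not_C4 {R : Set Edge} {z : ℕ} (h : ∀ e ∈ R, z ∈ e) : ¬ C4 R := by
  rintro ⟨f, hf⟩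
  have h1 : (SimpleGraph.cycleGraph 4).Adj 0 1 := by simp [SimpleGraph.cycleGraph_adj]
  have h2 : (SimpleGraph.cycleGraph 4).Adj 2 3 := by simp [SimpleGraph.cycleGraph_adj]
  have e1 := h _ ((SimpleGraph.fromEdgeSet_adj _).1 (f.map_adj h1)).1
  have e2 := h _ ((SimpleGraph.fromEdgeSet_adj _).1 (f.map_adj h2)).1
  rw [Sym2.mem_iff] at e1 e2
  rcases e1 with e1 | e1 <;> rcases e2 with e2 | e2 <;>
    exact absurd (hf (e1.symm.trans e2)) (by decide)

lemma start_win {s : Pos} {f p q D R B} {n k r c : ℕ} (hw : Win s k r) (hs : Rep s f p q D R B)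
    (hn : 1 ≤ n) (hR : R.Finite) (hk : B.ncard + k = n - 1) (hc : (R ∪ B).ncard ≤ c)
    (hr : c + k + r ≤ 2 * n - 2) : RRWin n R B :=
  RRWin_of_WinIn hR hs.finB (by omega) ((hw n f p q D R B hn hs hk).mono (by omega))

/-- For every `n ≥ 8`, Builder has a winning strategy in `RR(C₄, Pₙ, G)` when `G`
is the empty graph, a `b`-path, a `br`-path, a `brb`-path, a `brr`-path, or a
`brrb`-path. -/
theorem RR_win_small_starts (n : ℕ) (hn : 8 ≤ n) :
    -- empty graph
    RRWin n ∅ ∅ ∧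
    -- `b`-path
    RRWin n ∅ {s(0, 1)} ∧
    -- `br`-path
    RRWin n {s(1, 2)} {s(0, 1)} ∧
    -- `brb`-path
    RRWin n {s(1, 2)} {s(0, 1), s(2, 3)} ∧
    -- `brr`-path
    RRWin n {s(1, 2), s(2, 3)} {s(0, 1)} ∧
    -- `brrb`-path
    RRWin n {s(1, 2), s(2, 3)} {s(0, 1), s(3, 4)} := by
  obtain ⟨i, rfl⟩ : ∃ i, n = 8 + i := ⟨n - 8, by omega⟩
  have hF := fam_zero (i + 1)
  rw [show 4 + (i + 1) = 5 + i by omega] at hF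
  obtain ⟨w1, w2, w3, w4, w5⟩ := hF
  have w0 : Win pO (7 + i) (7 + i) := by
    have e : ∀ a b c : ℕ, a + b = c → a + i + b = c + i := by omega
    rw [e 5 1 6 rfl] at w3 w4 w5
    rw [e 5 2 7 rfl] at w5
    have := win_empty (K := 6 + i) (M := 4 + i) (by rw [e 4 3 7 rfl]; exact w5)
      (by rw [e 4 2 6 rfl]; exact w4) (by rw [e 4 1 5 rfl]; exact w3) (q_all i)
    rwa [e 6 1 7 rfl, e 4 3 7 rfl] at this
  have c0 : ¬ C4 ∅ := not_C4 (z := 2) (by simp)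
  have c1 : ¬ C4 {s(1, 2)} := not_C4 (z := 2) (by simp)
  have c2 : ¬ C4 {s(1, 2), s(2, 3)} := not_C4 (z := 2) (by simp)
  have n1 : ({s(0, 1)} : Set Edge).ncard = 1 := Set.ncard_singleton _
  have n2 : ({s(0, 1), s(2, 3)} : Set Edge).ncard = 2 := Set.ncard_pair (by decide)
  have n3 : ({s(0, 1), s(3, 4)} : Set Edge).ncard = 2 := Set.ncard_pair (by decide)
  have m1 : ({s(1, 2)} : Set Edge).ncard ≤ 1 := (Set.ncard_singleton _).le
  have m2 : ({s(1, 2), s(2, 3)} : Set Edge).ncard ≤ 2 := (Set.ncard_pair (by decide)).le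
  have un : ∀ X Y : Set Edge, (X ∪ Y).ncard ≤ X.ncard + Y.ncard := Set.ncard_union_le
  refine ⟨?_, ?_, ?_, ?_, ?_, ?_⟩
  · refine start_win (c := 0) w0 (rep_bare (red := []) (m := 0) c0 (by simp)) (by omega)
      Set.finite_empty (by simp) (by simp) (by omega)
  · have hs := ((rep_bare (red := []) (m := 2) c0 (by simp)).blue (x := 0) (y := 1) rfl rfl
      (by decide) (by decide)).2.2
    rw [insert_empty_eq] at hs
    exact start_win (c := 1) (s := pB) w5 hs (by omega) Set.finite_empty
      (by rw [n1]; omega) (by simp) (by omega)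
  · have hs := ((rep_bare (red := [(1, 2)]) (m := 3) c1 (by simp)).blue (x := 0) (y := 1) rfl rfl
      (by decide) (by decide)).2.2
    rw [insert_empty_eq] at hs
    exact start_win (c := 2) (s := pBr) w4 hs (by omega) (Set.toFinite _)
      (by rw [n1]; omega) ((un _ _).trans (by rw [n1]; omega)) (by omega)
  · have hs := ((rep_bare (red := [(1, 2)]) (m := 4) c1 (by simp)).blue (x := 2) (y := 3) rfl rfl
      (by decide) (by decide)).2.2
    replace hs := (hs.blue (x := 0) (y := 1) rfl rfl (by decide) (by decide)).2.2
    rw [insert_empty_eq] at hs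
    exact start_win (c := 3) (s := pBrb) w2 hs (by omega) (Set.toFinite _)
      (by rw [n2]; omega)
      ((un _ _).trans (by rw [n2]; omega)) (by omega)
  · have hs := ((rep_bare (red := [(1, 2), (2, 3)]) (m := 4) c2 (by simp; omega)).blue (x := 0) (y := 1)
      rfl rfl (by decide) (by decide)).2.2
    rw [insert_empty_eq] at hs
    exact start_win (c := 3) (s := pBrr) w3 hs (by omega) (Set.toFinite _)
      (by rw [n1]; omega) ((un _ _).trans (by rw [n1]; omega)) (by omega)
  · have hs := ((rep_bare (red := [(1, 2), (2, 3)]) (m := 5) c2 (by simp; omega)).blue (x := 3) (y := 4)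
      rfl rfl (by decide) (by decide)).2.2
    replace hs := (hs.blue (x := 0) (y := 1) rfl rfl (by decide) (by decide)).2.2
    rw [insert_empty_eq] at hs
    exact start_win (c := 4) (s := pBrrb) w1 hs (by omega) (Set.toFinite _)
      (by rw [n3]; omega)
      ((un _ _).trans (by rw [n3]; omega)) (by omega)

end OnlineRamsey
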